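/- arXiv:2302.01655 — 2 statements merged into one kernel-verified Lean document; each statement's English description precedes it below -/
import Mathlib

section
/- There is an absolute constant C > 0 with the following property. Let q0 be a prime power and F a finite field with q0² elements with involution x ↦ x^{q0}. Let n ≥ 1, let a ∈ U, let I_1, …, I_r be a partition of the set of †-irreducible polynomials over F of degree ≤ n, and let m_1, …, m_r ≥ 0 be integers such that m_i = 0 whenever I_i is empty. Then the number of squarefree †-symmetric monic polynomials f of degree n over F with constant coefficient a having exactly m_i distinct †-irreducible factors in I_i for each i is at most C·q0^{n−1}·∏_{i=1}^r ( e^{−H†(I_i)}·H†(I_i)^{m_i}/m_i! )·( m_1/H†(I_1) + ⋯ + m_r/H†(I_r) ), where terms m_i/H†(I_i) with m_i = 0 are interpreted as 0. -/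
open Polynomial

/-- `f` is †-symmetric with respect to the involution `σ`. -/
def IsDaggerSymm {F : Type} [Field F] (σ : F →+* F) (f : F[X]) : Prop :=
  f.coeff 0 ≠ 0 ∧ (f.map σ).reverse = Polynomial.C (σ (f.coeff 0)) * f

/-- A monic †-symmetric polynomial of positive degree is †-irreducible if it has no proper
†-symmetric monic divisor of positive degree. -/
def IsDaggerIrreducible {F : Type} [Field F] (σ : F →+* F) (f : F[X]) : Prop :=
  f.Monic ∧ 0 < f.natDegree ∧ IsDaggerSymm σ f ∧
    ∀ g : F[X], g.Monic → IsDaggerSymm σ g → g ∣ f →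
      0 < g.natDegree → g.natDegree < f.natDegree → False

/-- `H†(I) = ∑_{g ∈ I} (q0²)^{-(deg g)/2} = ∑_{g ∈ I} q0^{-deg g}`. -/
noncomputable def polyHdagger (q0 : ℕ) {F : Type} [Field F] (I : Set F[X]) : ℝ :=
  ∑ᶠ g ∈ I, ((q0 : ℝ) ^ g.natDegree)⁻¹

/-- Double counting of pairs (subset, marked element) by removing the marked element. -/
theorem sum_powersetCard_succ_sum_erase_le {G : Type*} [DecidableEq G] (s : Finset G) (m : ℕ)
    (w : Finset G → G → ℝ) (hw : ∀ T g, 0 ≤ w T g) :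
    ∑ T ∈ s.powersetCard (m + 1), ∑ g ∈ T, w (T.erase g) g ≤
      ∑ T ∈ s.powersetCard m, ∑ g ∈ s, w T g := by
  rw [Finset.sum_sigma', ← Finset.sum_product']
  let φ : (Σ _ : Finset G, G) → Finset G × G := fun x => (x.1.erase x.2, x.2)
  have hinj : Set.InjOn φ ((s.powersetCard (m + 1)).sigma fun T => T) := by
    rintro ⟨T, g⟩ h ⟨T', g'⟩ h' e
    simp only [Finset.coe_sigma, Set.mem_sigma_iff, Finset.mem_coe] at h h'
    simp only [φ, Prod.mk.injEq] at e
    obtain ⟨e, rfl⟩ := e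
    have : T = T' := by
      rw [← Finset.insert_erase h.2, e, Finset.insert_erase h'.2]
    rw [this]
  calc _ = ∑ x ∈ ((s.powersetCard (m + 1)).sigma fun T => T).image φ, w x.1 x.2 := by
        rw [Finset.sum_image hinj]
    _ ≤ _ := by
        refine Finset.sum_le_sum_of_subset_of_nonneg ?_ fun x _ _ => hw _ _
        intro x hx
        simp only [Finset.mem_image, Finset.mem_sigma, Finset.mem_powersetCard] at hx
        obtain ⟨⟨T, g⟩, ⟨⟨hT, hc⟩, hg⟩, rfl⟩ := hx
        simp only [φ, Finset.mem_product, Finset.mem_powersetCard]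
        refine ⟨⟨(Finset.erase_subset _ _).trans hT, ?_⟩, hT hg⟩
        rw [Finset.card_erase_of_mem hg, hc]; rfl

/-- The elementary symmetric sums of nonnegative weights are at most `(∑ w) ^ m / m!`. -/
theorem sum_powersetCard_prod_le {G : Type*} [DecidableEq G] (s : Finset G) (w : G → ℝ)
    (hw : ∀ g, 0 ≤ w g) (m : ℕ) :
    ∑ T ∈ s.powersetCard m, ∏ g ∈ T, w g ≤ (∑ g ∈ s, w g) ^ m / (m.factorial : ℝ) := by
  induction m with
  | zero => simp
  | succ m ih =>
    have key := sum_powersetCard_succ_sum_erase_le s m (fun T g => (∏ x ∈ T, w x) * w g)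
      fun T g => mul_nonneg (Finset.prod_nonneg fun x _ => hw x) (hw g)
    have h1 : ∑ T ∈ s.powersetCard (m + 1), ∑ g ∈ T, (∏ x ∈ T.erase g, w x) * w g =
        (m + 1 : ℝ) * ∑ T ∈ s.powersetCard (m + 1), ∏ g ∈ T, w g := by
      rw [Finset.mul_sum]
      refine Finset.sum_congr rfl fun T hT => ?_
      rw [Finset.sum_congr rfl fun g hg => Finset.prod_erase_mul T w hg, Finset.sum_const,
        (Finset.mem_powersetCard.1 hT).2, nsmul_eq_mul]
      push_cast; rfl
    rw [h1, ← Finset.sum_mul_sum] at key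
    have hH : 0 ≤ ∑ g ∈ s, w g := Finset.sum_nonneg fun g _ => hw g
    have h2 := key.trans (mul_le_mul_of_nonneg_right ih hH)
    have hf : (0 : ℝ) < m.factorial := by positivity
    rw [Nat.factorial_succ, le_div_iff₀ (by positivity)]
    rw [div_mul_eq_mul_div, le_div_iff₀ hf] at h2
    push_cast
    rw [pow_succ]
    linarith

/-- The tuples of `m i`-element subsets of the `I i`. -/
abbrev subsetTuples {G : Type*} [DecidableEq G] {r : ℕ} (I : Fin r → Finset G) (m : Fin r → ℕ) :
    Finset (Fin r → Finset G) :=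
  Fintype.piFinset fun j => (I j).powersetCard (m j)

theorem sum_subsetTuples_prod_le {G : Type*} [DecidableEq G] {r : ℕ} (I : Fin r → Finset G)
    (m : Fin r → ℕ) (w : G → ℝ) (hw : ∀ g, 0 ≤ w g) :
    ∑ T ∈ subsetTuples I m, ∏ j, ∏ g ∈ T j, w g ≤
      ∏ j, ((∑ g ∈ I j, w g) ^ m j / ((m j).factorial : ℝ)) := by
  rw [← Finset.prod_univ_sum (fun j => (I j).powersetCard (m j)) (fun _ S => ∏ g ∈ S, w g)]
  exact Finset.prod_le_prod
    (fun j _ => Finset.sum_nonneg fun S _ => Finset.prod_nonneg fun g _ => hw g)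
    fun j _ => sum_powersetCard_prod_le (I j) w hw (m j)

/-- Tuples of subsets of total degree `n` and total constant `a`, with a marked element in the
`i`-th subset, weighted by the degree of that element. -/
theorem sum_marked_subsetTuples_le {G K : Type*} [DecidableEq G] [Field K] [DecidableEq K]
    {r q : ℕ} (hq : 0 < q) (I : Fin r → Finset G) (m : Fin r → ℕ) (d : G → ℕ) (c : G → K)
    (hc : ∀ g, (∃ i, g ∈ I i) → c g ≠ 0)
    (hI : ∀ i k b, 1 ≤ k → k * ((I i).filter fun g => d g = k ∧ c g = b).card ≤ q ^ (k - 1))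
    (n : ℕ) (a : K) (i : Fin r) :
    ∑ T ∈ (subsetTuples I m).filter (fun T => ∑ j, ∑ g ∈ T j, d g = n ∧ ∏ j, ∏ g ∈ T j, c g = a),
      ∑ g ∈ T i, (d g : ℝ) ≤
    (q : ℝ) ^ (n - 1) *
      ((∏ j, ((∑ g ∈ I j, ((q : ℝ) ^ d g)⁻¹) ^ m j / ((m j).factorial : ℝ))) *
        ((m i : ℝ) / ∑ g ∈ I i, ((q : ℝ) ^ d g)⁻¹)) := by
  set w : G → ℝ := fun g => ((q : ℝ) ^ d g)⁻¹ with hw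
  have hq' : (0 : ℝ) < q := by exact_mod_cast hq
  have hwpos : ∀ g, 0 < w g := fun g => by positivity
  have hsum : ∀ j, 0 ≤ ∑ g ∈ I j, w g := fun j => Finset.sum_nonneg fun g _ => (hwpos g).le
  set A := (subsetTuples I m).filter
    (fun T => ∑ j, ∑ g ∈ T j, d g = n ∧ ∏ j, ∏ g ∈ T j, c g = a) with hA
  have hmem : ∀ T ∈ A, ∀ j, T j ⊆ I j ∧ (T j).card = m j := fun T hT j => by
    have := (Finset.mem_filter.1 hT).1
    rw [Fintype.mem_piFinset] at this
    exact Finset.mem_powersetCard.1 (this j)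
  by_cases h0 : ∑ T ∈ A, ∑ g ∈ T i, (d g : ℝ) = 0
  · rw [h0]
    refine mul_nonneg (by positivity) (mul_nonneg (Finset.prod_nonneg fun j _ => ?_) ?_)
    · exact div_nonneg (pow_nonneg (hsum j) _) (by positivity)
    · exact div_nonneg (by positivity) (hsum i)
  obtain ⟨T₀, hT₀, h0⟩ := Finset.exists_ne_zero_of_sum_ne_zero h0
  obtain ⟨g₀, hg₀, -⟩ := Finset.exists_ne_zero_of_sum_ne_zero h0
  have hH : 0 < ∑ g ∈ I i, w g :=
    Finset.sum_pos (fun g _ => hwpos g) ⟨g₀, (hmem T₀ hT₀ i).1 hg₀⟩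
  obtain ⟨p, hp⟩ : ∃ p, m i = p + 1 := Nat.exists_eq_succ_of_ne_zero <| by
    rw [← (hmem T₀ hT₀ i).2]; exact Finset.card_ne_zero_of_mem hg₀
  set m' := Function.update m i p with hm'
  let φ : (Σ _ : Fin r → Finset G, G) → (Fin r → Finset G) × G :=
    fun x => (Function.update x.1 i ((x.1 i).erase x.2), x.2)
  have hinj : Set.InjOn φ (A.sigma fun T => T i) := by
    rintro ⟨T, g⟩ h ⟨T', g'⟩ h' e
    simp only [Finset.coe_sigma, Set.mem_sigma_iff, Finset.mem_coe] at h h'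
    simp only [φ, Prod.mk.injEq] at e
    obtain ⟨e, rfl⟩ := e
    have : T = T' := by
      funext j
      have ej := congrFun e j
      by_cases hj : j = i
      · subst hj
        simp only [Function.update_self] at ej
        rw [← Finset.insert_erase h.2, ej, Finset.insert_erase h'.2]
      · simpa [Function.update_of_ne hj] using ej
    rw [this]
  let B : Finset ((Fin r → Finset G) × G) := (subsetTuples I m' ×ˢ I i).filter fun x =>
    d x.2 + ∑ j, ∑ g ∈ x.1 j, d g = n ∧ c x.2 * ∏ j, ∏ g ∈ x.1 j, c g = a
  have hsub : (A.sigma fun T => T i).image φ ⊆ B := by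
    intro x hx
    simp only [Finset.mem_image, Finset.mem_sigma] at hx
    obtain ⟨⟨T, g⟩, ⟨hT, hg⟩, rfl⟩ := hx
    simp only at hT hg
    have hTA := (Finset.mem_filter.1 hT).2
    simp only [B, φ, Finset.mem_filter, Finset.mem_product]
    have hrest : ∀ j ∈ Finset.univ.erase i,
        Function.update T i ((T i).erase g) j = T j := fun j hj =>
      Function.update_of_ne (Finset.ne_of_mem_erase hj) _ _
    refine ⟨⟨?_, (hmem T hT i).1 hg⟩, ?_, ?_⟩
    · rw [Fintype.mem_piFinset]
      intro j
      rw [Finset.mem_powersetCard]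
      by_cases hj : j = i
      · subst hj
        simp only [hm', Function.update_self]
        refine ⟨(Finset.erase_subset _ _).trans (hmem T hT j).1, ?_⟩
        rw [Finset.card_erase_of_mem hg, (hmem T hT j).2, hp]; rfl
      · simp only [hm', Function.update_of_ne hj]
        exact hmem T hT j
    · rw [← hTA.1, ← Finset.add_sum_erase _ _ (Finset.mem_univ i),
        ← Finset.add_sum_erase _ _ (Finset.mem_univ i), Function.update_self, ← add_assoc,
        Finset.add_sum_erase _ _ hg]
      congr 1
      exact Finset.sum_congr rfl fun j hj => by rw [hrest j hj]
    · rw [← hTA.2, ← Finset.mul_prod_erase _ _ (Finset.mem_univ i),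
        ← Finset.mul_prod_erase _ _ (Finset.mem_univ i), Function.update_self, ← mul_assoc,
        Finset.mul_prod_erase _ _ hg]
      congr 1
      exact Finset.prod_congr rfl fun j hj => by rw [hrest j hj]
  have hfiber : ∀ T ∈ subsetTuples I m', ∑ g ∈ (I i).filter (fun g =>
      d g + ∑ j, ∑ g ∈ T j, d g = n ∧ c g * ∏ j, ∏ g ∈ T j, c g = a), (d g : ℝ) ≤
      (q : ℝ) ^ (n - 1) * ∏ j, ∏ g ∈ T j, w g := by
    intro T hT
    rw [Fintype.mem_piFinset] at hT
    set D := ∑ j, ∑ g ∈ T j, d g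
    set P := ∏ j, ∏ g ∈ T j, c g
    have hP : P ≠ 0 := Finset.prod_ne_zero_iff.2 fun j _ => Finset.prod_ne_zero_iff.2 fun g hg =>
      hc g ⟨j, (Finset.mem_powersetCard.1 (hT j)).1 hg⟩
    have hwD : ∏ j, ∏ g ∈ T j, w g = ((q : ℝ) ^ D)⁻¹ := by
      simp only [hw, D, Finset.prod_inv_distrib, Finset.prod_pow_eq_pow_sum]
    have hle : ∑ g ∈ (I i).filter (fun g => d g + D = n ∧ c g * P = a), (d g : ℝ) ≤
        ∑ g ∈ (I i).filter (fun g => d g = n - D ∧ c g = a / P), ((n - D : ℕ) : ℝ) := by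
      refine (Finset.sum_le_sum_of_subset_of_nonneg ?_ fun _ _ _ => by positivity).trans
        (Finset.sum_le_sum fun g hg => ?_)
      · intro g hg
        simp only [Finset.mem_filter] at hg ⊢
        exact ⟨hg.1, by omega, by rw [eq_div_iff hP, hg.2.2]⟩
      · rw [(Finset.mem_filter.1 hg).2.1]
    refine hle.trans ?_
    rw [hwD, Finset.sum_const, nsmul_eq_mul]
    rcases Nat.eq_zero_or_pos (n - D) with h | h
    · rw [h]; simp; positivity
    · have h1 := hI i (n - D) (a / P) h
      rw [← div_eq_mul_inv, le_div_iff₀ (by positivity)]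
      have h2 : (q : ℝ) ^ (n - 1) = (q : ℝ) ^ (n - D - 1) * (q : ℝ) ^ D := by
        rw [← pow_add]; congr 1; omega
      rw [h2]
      refine mul_le_mul_of_nonneg_right ?_ (by positivity)
      rw [mul_comm]
      exact_mod_cast h1
  calc ∑ T ∈ A, ∑ g ∈ T i, (d g : ℝ)
      = ∑ x ∈ (A.sigma fun T => T i).image φ, (d x.2 : ℝ) := by
        rw [Finset.sum_image hinj, Finset.sum_sigma]
    _ ≤ ∑ x ∈ B, (d x.2 : ℝ) :=
        Finset.sum_le_sum_of_subset_of_nonneg hsub fun _ _ _ => by positivity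
    _ ≤ ∑ T ∈ subsetTuples I m', (q : ℝ) ^ (n - 1) * ∏ j, ∏ g ∈ T j, w g := by
        rw [Finset.sum_filter, Finset.sum_product]
        refine Finset.sum_le_sum fun T hT => ?_
        rw [← Finset.sum_filter]
        exact hfiber T hT
    _ ≤ (q : ℝ) ^ (n - 1) * ∏ j, ((∑ g ∈ I j, w g) ^ m' j / ((m' j).factorial : ℝ)) := by
        rw [← Finset.mul_sum]
        exact mul_le_mul_of_nonneg_left (sum_subsetTuples_prod_le I m' w fun g => (hwpos g).le)
          (by positivity)
    _ = _ := by
        congr 1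
        rw [← Finset.mul_prod_erase _ _ (Finset.mem_univ i),
          ← Finset.mul_prod_erase _ (fun j => (∑ g ∈ I j, w g) ^ m j / ((m j).factorial : ℝ))
            (Finset.mem_univ i), mul_right_comm]
        congr 1
        · simp only [hm', Function.update_self, hp, Nat.factorial_succ, pow_succ]
          push_cast
          field_simp
        · exact Finset.prod_congr rfl fun j hj => by
            simp only [hm', Function.update_of_ne (Finset.ne_of_mem_erase hj)]

/-- A count of tuples of subsets of total degree `n` and total constant `a`. -/
theorem card_subsetTuples_le {G K : Type*} [DecidableEq G] [Field K] [DecidableEq K]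
    {r q : ℕ} (hq : 0 < q) (I : Fin r → Finset G) (m : Fin r → ℕ) (d : G → ℕ) (c : G → K)
    (hc : ∀ g, (∃ i, g ∈ I i) → c g ≠ 0)
    (hI : ∀ i k b, 1 ≤ k → k * ((I i).filter fun g => d g = k ∧ c g = b).card ≤ q ^ (k - 1))
    (n : ℕ) (a : K) :
    (n : ℝ) * ((subsetTuples I m).filter
      (fun T => ∑ j, ∑ g ∈ T j, d g = n ∧ ∏ j, ∏ g ∈ T j, c g = a)).card ≤
    (q : ℝ) ^ (n - 1) *
      (∏ j, ((∑ g ∈ I j, ((q : ℝ) ^ d g)⁻¹) ^ m j / ((m j).factorial : ℝ))) *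
        ∑ i, (m i : ℝ) / ∑ g ∈ I i, ((q : ℝ) ^ d g)⁻¹ := by
  rw [Finset.mul_sum]
  refine le_trans (le_of_eq ?_) (Finset.sum_le_sum fun i _ =>
    (sum_marked_subsetTuples_le hq I m d c hc hI n a i).trans_eq (mul_assoc _ _ _).symm)
  rw [Finset.sum_comm, mul_comm, ← nsmul_eq_mul, ← Finset.sum_const]
  refine Finset.sum_congr rfl fun T hT => ?_
  rw [← (Finset.mem_filter.1 hT).2.1]
  push_cast
  rfl

theorem polynomial_reverse_map {R S : Type*} [Semiring R] [Semiring S] (f : R →+* S)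
    (hf : Function.Injective f) (p : R[X]) : (p.map f).reverse = p.reverse.map f := by
  ext n
  rw [coeff_reverse, coeff_map, coeff_map, coeff_reverse, natDegree_map_eq_of_injective hf]

theorem polynomial_reverse_prod {R ι : Type*} [CommRing R] [IsDomain R] (s : Finset ι)
    (f : ι → R[X]) : (∏ i ∈ s, f i).reverse = ∏ i ∈ s, (f i).reverse := by
  classical
  induction s using Finset.induction_on with
  | empty => simpa using reverse_C (1 : R)
  | insert i s hi ih => rw [Finset.prod_insert hi, Finset.prod_insert hi, reverse_mul_of_domain, ih]

theorem reverse_X_sub_C {K : Type*} [Field K] {b : K} (hb : b ≠ 0) :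
    (X - C b : K[X]).reverse = C (-b) * (X - C b⁻¹) := by
  have h : (X - C b : K[X]) = C (-b) + X * C 1 := by rw [C_neg, C_1, mul_one]; ring
  rw [h, reverse_C_add, reverse_X_mul, reverse_C, C_1, mul_one, natDegree_X, pow_one, mul_sub,
    ← C_mul, neg_mul, mul_inv_cancel₀ hb, C_neg, C_neg, C_1]
  ring

theorem prod_range_succ_of_periodic {M : Type*} [CommMonoid M] (f : ℕ → M) (k : ℕ)
    (h : f k = f 0) : ∏ i ∈ Finset.range k, f (i + 1) = ∏ i ∈ Finset.range k, f i := by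
  cases k with
  | zero => simp
  | succ k => rw [Finset.prod_range_succ, h, Finset.prod_range_succ']

/-- The twisted Frobenius `x ↦ x ^ (-q)`. -/
def twistedFrob {L : Type*} [Field L] (q : ℕ) (x : L) : L := (x ^ q)⁻¹

theorem twistedFrob_injective {L : Type*} [Field L] {q : ℕ} (τ : L →+* L)
    (hτ : ∀ x, τ x = x ^ q) : Function.Injective (twistedFrob q : L → L) := fun x y h => by
  simp only [twistedFrob, inv_inj, ← hτ] at h
  exact τ.injective h

theorem twistedFrob_iterate {L : Type*} [Field L] (q : ℕ) (x : L) (i : ℕ) :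
    (twistedFrob q)^[i] x = x ^ ((-(q : ℤ)) ^ i) := by
  induction i with
  | zero => simp
  | succ i ih =>
    rw [Function.iterate_succ_apply', ih, twistedFrob, pow_succ, zpow_mul, zpow_neg, zpow_natCast]

namespace IsDaggerSymm

variable {F : Type} [Field F] {σ : F →+* F}

theorem mul {f g : F[X]} (hf : IsDaggerSymm σ f) (hg : IsDaggerSymm σ g) :
    IsDaggerSymm σ (f * g) := by
  refine ⟨by rw [mul_coeff_zero]; exact mul_ne_zero hf.1 hg.1, ?_⟩
  rw [Polynomial.map_mul, reverse_mul_of_domain, hf.2, hg.2, mul_coeff_zero, map_mul, C_mul]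
  ring

theorem one : IsDaggerSymm σ (1 : F[X]) :=
  ⟨by simp, by simpa using reverse_C (1 : F)⟩

theorem prod {ι : Type*} (s : Finset ι) (f : ι → F[X]) (h : ∀ i ∈ s, IsDaggerSymm σ (f i)) :
    IsDaggerSymm σ (∏ i ∈ s, f i) := by
  classical
  induction s using Finset.induction_on with
  | empty => simpa using one
  | insert i s hi ih =>
    rw [Finset.prod_insert hi]
    exact (h i (Finset.mem_insert_self i s)).mul
      (ih fun j hj => h j (Finset.mem_insert_of_mem hj))

theorem of_mul_left {f g : F[X]} (hf : IsDaggerSymm σ f) (hfg : IsDaggerSymm σ (f * g)) :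
    IsDaggerSymm σ g := by
  have h0 := hfg.1
  rw [mul_coeff_zero] at h0
  refine ⟨right_ne_zero_of_mul h0, ?_⟩
  have h1 := hfg.2
  rw [Polynomial.map_mul, reverse_mul_of_domain, hf.2, mul_coeff_zero, map_mul, C_mul] at h1
  have h2 : C (σ (f.coeff 0)) * f ≠ 0 := by
    refine mul_ne_zero (C_ne_zero.2 ((map_ne_zero σ).2 hf.1)) ?_
    rintro rfl
    exact hf.1 (by simp)
  refine mul_left_cancel₀ h2 ?_
  rw [h1]
  ring

variable {L : Type*} [Field L] [Algebra F L] {q : ℕ} {τ : L →+* L}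

theorem aeval_twistedFrob (hσ : ∀ x, σ x = x ^ q) (hτ : ∀ x, τ x = x ^ q) {f : F[X]}
    (hf : IsDaggerSymm σ f) {α : L} (hα : aeval α f = 0) :
    α ≠ 0 ∧ aeval (twistedFrob q α) f = 0 := by
  have hα0 : α ≠ 0 := by
    rintro rfl
    rw [aeval_def, eval₂_at_zero, map_eq_zero] at hα
    exact hf.1 hα
  refine ⟨hα0, ?_⟩
  have hcomm : τ.comp (algebraMap F L) = (algebraMap F L).comp σ := by
    ext x
    simp [hσ, hτ]
  have h1 : eval₂ (algebraMap F L) (α ^ q) (f.map σ) = 0 := by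
    rw [eval₂_map, ← hcomm, ← hτ, ← hom_eval₂, ← aeval_def, hα, map_zero]
  have : Invertible (α ^ q) := invertibleOfNonzero (pow_ne_zero q hα0)
  have h2 := (eval₂_reverse_eq_zero_iff (algebraMap F L) (α ^ q) (f.map σ)).2 h1
  rw [hf.2, eval₂_mul, eval₂_C, mul_eq_zero, invOf_eq_inv] at h2
  exact h2.resolve_left
    ((map_ne_zero (algebraMap F L)).2 ((map_ne_zero σ).2 hf.1))

/-- A polynomial whose roots form one period of the twisted Frobenius is †-symmetric. -/
theorem of_map_eq_prod_iterate (hσ : ∀ x, σ x = x ^ q) (hτ : ∀ x, τ x = x ^ q) {g : F[X]} {k : ℕ}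
    {α : L} (hα : α ≠ 0) (hk : (twistedFrob q)^[k] α = α)
    (hg : g.map (algebraMap F L) = ∏ i ∈ Finset.range k, (X - C ((twistedFrob q)^[i] α))) :
    IsDaggerSymm σ g := by
  have hcomm : (algebraMap F L).comp σ = τ.comp (algebraMap F L) := by
    ext x
    simp [hσ, hτ]
  have hne : ∀ i, (twistedFrob q)^[i] α ≠ 0 := fun i => by
    rw [twistedFrob_iterate]
    exact zpow_ne_zero _ hα
  have hcoeff : algebraMap F L (g.coeff 0) =
      ∏ i ∈ Finset.range k, -((twistedFrob q)^[i] α) := by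
    rw [← coeff_map, hg, coeff_zero_prod]
    simp
  refine ⟨fun h => ?_, ?_⟩
  · rw [h, map_zero, eq_comm, Finset.prod_eq_zero_iff] at hcoeff
    obtain ⟨i, -, hi⟩ := hcoeff
    exact hne i (neg_eq_zero.1 hi)
  · apply map_injective (algebraMap F L) (algebraMap F L).injective
    rw [← polynomial_reverse_map _ (algebraMap F L).injective, Polynomial.map_map, hcomm,
      ← Polynomial.map_map, hg, Polynomial.map_prod, polynomial_reverse_prod, Polynomial.map_mul,
      hg, map_C, ← RingHom.comp_apply (algebraMap F L) σ, hcomm, RingHom.comp_apply, hcoeff,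
      map_prod, map_prod,
      ← prod_range_succ_of_periodic (fun i => (X - C ((twistedFrob q)^[i] α) : L[X])) k
        (by simp [hk]), ← Finset.prod_mul_distrib]
    refine Finset.prod_congr rfl fun i _ => ?_
    rw [Polynomial.map_sub, map_X, map_C, reverse_X_sub_C ((map_ne_zero τ).2 (hne i)), map_neg τ,
      Function.iterate_succ_apply', twistedFrob, hτ]

end IsDaggerSymm

theorem mem_range_algebraMap_of_pow_card_eq {F L : Type*} [Field F] [Fintype F] [Field L]
    [Algebra F L] {x : L} (hx : x ^ Fintype.card F = x) : x ∈ (algebraMap F L).range := by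
  classical
  have hne : (X ^ Fintype.card F - X : L[X]) ≠ 0 :=
    FiniteField.X_pow_card_sub_X_ne_zero L Fintype.one_lt_card
  have hsub : Finset.univ.image (algebraMap F L) ⊆
      (X ^ Fintype.card F - X : L[X]).roots.toFinset := by
    intro y hy
    obtain ⟨z, -, rfl⟩ := Finset.mem_image.1 hy
    rw [Multiset.mem_toFinset, mem_roots hne]
    simp [← map_pow, FiniteField.pow_card]
  have hcard : (X ^ Fintype.card F - X : L[X]).roots.toFinset.card ≤
      (Finset.univ.image (algebraMap F L)).card := by
    rw [Finset.card_image_of_injective _ (algebraMap F L).injective, Finset.card_univ]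
    refine (Multiset.toFinset_card_le _).trans ((card_roots' _).trans_eq ?_)
    exact FiniteField.X_pow_card_sub_X_natDegree_eq L Fintype.one_lt_card
  have hmem : x ∈ (X ^ Fintype.card F - X : L[X]).roots.toFinset := by
    rw [Multiset.mem_toFinset, mem_roots hne]
    simp [hx]
  rw [← Finset.eq_of_subset_of_card_le hsub hcard] at hmem
  obtain ⟨z, -, rfl⟩ := Finset.mem_image.1 hmem
  exact ⟨z, rfl⟩

section Irreducible

variable {F : Type} [Field F] [Fintype F] {σ : F →+* F} {L : Type*} [Field L] [Algebra F L]
  {q : ℕ} {τ : L →+* L}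

/-- The product over one period of the twisted Frobenius descends to the base field. -/
theorem exists_map_eq_prod_iterate (hq : Fintype.card F = q ^ 2) (hτ : ∀ x, τ x = x ^ q)
    {k : ℕ} {α : L} (hk : (twistedFrob q)^[k] α = α) :
    ∃ g : F[X], g.Monic ∧
      g.map (algebraMap F L) = ∏ i ∈ Finset.range k, (X - C ((twistedFrob q)^[i] α)) := by
  set P := ∏ i ∈ Finset.range k, (X - C ((twistedFrob q)^[i] α)) with hP
  have hmonic : P.Monic := monic_prod_of_monic _ _ fun i _ => monic_X_sub_C _
  have hshift := (prod_range_succ_of_periodic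
      (fun i => (X - C ((twistedFrob q)^[i + 1] α) : L[X])) k (by
        simp only [Function.iterate_succ_apply', hk, Function.iterate_zero, id])).trans
    (prod_range_succ_of_periodic (fun i => (X - C ((twistedFrob q)^[i] α) : L[X])) k
      (by simp [hk]))
  have hfix : P.map (τ.comp τ) = P := by
    conv_rhs => rw [hP, ← hshift]
    rw [hP, Polynomial.map_prod]
    refine Finset.prod_congr rfl fun i _ => ?_
    rw [Polynomial.map_sub, map_X, map_C]
    simp only [Function.iterate_succ_apply', RingHom.comp_apply, hτ, twistedFrob, inv_pow, inv_inv]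
  have hlift : P ∈ lifts (algebraMap F L) := by
    rw [lifts_iff_coeff_lifts]
    intro n
    refine mem_range_algebraMap_of_pow_card_eq ?_
    conv_rhs => rw [← hfix]
    rw [coeff_map, RingHom.comp_apply, hτ, hτ, hq, ← pow_mul, sq]
  obtain ⟨g, hg, -, hgm⟩ := lifts_and_natDegree_eq_and_monic hlift hmonic
  exact ⟨g, hgm, hg⟩

/-- The roots of a †-irreducible polynomial form one period of the twisted Frobenius. -/
theorem IsDaggerIrreducible.map_eq_prod_iterate (hq : Fintype.card F = q ^ 2)
    (hσ : ∀ x, σ x = x ^ q) (hτ : ∀ x, τ x = x ^ q) {f : F[X]} (hf : IsDaggerIrreducible σ f)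
    {α : L} (hα : aeval α f = 0) :
    α ≠ 0 ∧ (twistedFrob q)^[f.natDegree] α = α ∧
      Set.InjOn (fun i => (twistedFrob q)^[i] α) (Finset.range f.natDegree) ∧
      f.map (algebraMap F L) =
        ∏ i ∈ Finset.range f.natDegree, (X - C ((twistedFrob q)^[i] α)) := by
  classical
  obtain ⟨hfm, -, hfs, hmin⟩ := hf
  have hα0 := (hfs.aeval_twistedFrob hσ hτ hα).1
  have hroot : ∀ i, aeval ((twistedFrob q)^[i] α) f = 0 := fun i => by
    induction i with
    | zero => exact hα
    | succ i ih =>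
      rw [Function.iterate_succ_apply']
      exact (hfs.aeval_twistedFrob hσ hτ ih).2
  have hfm' : f.map (algebraMap F L) ≠ 0 := (hfm.map _).ne_zero
  have hper : α ∈ Function.periodicPts (twistedFrob q : L → L) := by
    have hfin : (f.rootSet L).Finite := rootSet_finite f L
    obtain ⟨i, -, j, -, hij, h⟩ := Set.infinite_univ.exists_ne_map_eq_of_mapsTo
      (f := fun i : ℕ => (twistedFrob q)^[i] α)
      (fun i _ => (mem_rootSet_of_ne hfm.ne_zero).2 (hroot i)) hfin
    wlog hlt : j < i generalizing i j
    · exact this j i hij.symm h.symm (by omega)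
    exact Function.mk_mem_periodicPts (Nat.sub_pos_of_lt hlt)
      (Function.iterate_cancel (twistedFrob_injective τ hτ) h)
  set k := Function.minimalPeriod (twistedFrob q) α with hk
  have hkpos : 0 < k := Function.minimalPeriod_pos_of_mem_periodicPts hper
  have hkα : (twistedFrob q)^[k] α = α := Function.iterate_minimalPeriod
  have hinj : Set.InjOn (fun i => (twistedFrob q)^[i] α) (Finset.range k) := by
    rw [Finset.coe_range]
    exact Function.iterate_injOn_Iio_minimalPeriod
  obtain ⟨g, hgm, hg⟩ := exists_map_eq_prod_iterate hq hτ hkα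
  have hgs := IsDaggerSymm.of_map_eq_prod_iterate hσ hτ hα0 hkα hg
  have hdeg : g.natDegree = k := by
    rw [← natDegree_map (algebraMap F L), hg, natDegree_prod_of_monic _ _
      fun i _ => monic_X_sub_C _]
    simp
  have hdvd : g ∣ f := by
    rw [← map_dvd_map' (algebraMap F L), hg]
    refine Finset.prod_dvd_of_coprime (fun i hi j hj hij => ?_) fun i _ => ?_
    · exact pairwise_coprime_X_sub_C Function.injective_id (fun h => hij (hinj hi hj h))
    · rw [dvd_iff_isRoot, IsRoot.def, eval_map_algebraMap]
      exact hroot i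
  have hle := natDegree_le_of_dvd hdvd hfm.ne_zero
  have hfg : g = f := by
    rcases hle.lt_or_eq with hlt | heq
    · exact (hmin g hgm hgs hdvd (by omega) hlt).elim
    · exact (eq_of_monic_of_dvd_of_natDegree_le hgm hfm hdvd heq.ge).symm
  rw [← hfg, hdeg]
  exact ⟨hα0, hkα, hinj, hg⟩

theorem IsDaggerIrreducible.eq_of_aeval_eq_zero (hq : Fintype.card F = q ^ 2)
    (hσ : ∀ x, σ x = x ^ q) (hτ : ∀ x, τ x = x ^ q) {f g : F[X]} (hf : IsDaggerIrreducible σ f)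
    (hg : IsDaggerIrreducible σ g) {α : L} (hfα : aeval α f = 0) (hgα : aeval α g = 0) :
    f = g := by
  obtain ⟨-, hf1, hf2, hf3⟩ := hf.map_eq_prod_iterate hq hσ hτ hfα
  obtain ⟨-, hg1, hg2, hg3⟩ := hg.map_eq_prod_iterate hq hσ hτ hgα
  have hdeg : f.natDegree = g.natDegree := by
    rcases lt_trichotomy f.natDegree g.natDegree with h | h | h
    · have := hg2 (x₁ := f.natDegree) (x₂ := 0) (by simpa using h) (by simp; omega)
        (by simpa using hf1)
      exact absurd this hf.2.1.ne'
    · exact h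
    · have := hf2 (x₁ := g.natDegree) (x₂ := 0) (by simpa using h) (by simp; omega)
        (by simpa using hg1)
      exact absurd this hg.2.1.ne'
  apply map_injective (algebraMap F L) (algebraMap F L).injective
  rw [hf3, hg3, hdeg]

end Irreducible

theorem card_le_natAbs_of_zpow_eq {L : Type*} [Field L] (s : Finset L) {e : ℤ} (he : e ≠ 0) (c : L)
    (h : ∀ α ∈ s, α ^ e = c) : s.card ≤ e.natAbs := by
  classical
  obtain ⟨c', hc'⟩ : ∃ c' : L, ∀ α ∈ s, α ^ e.natAbs = c' := by
    rcases Int.natAbs_eq e with h1 | h1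
    · refine ⟨c, fun α hα => ?_⟩
      rw [← h α hα]
      conv_rhs => rw [h1, zpow_natCast]
    · refine ⟨c⁻¹, fun α hα => ?_⟩
      rw [← h α hα]
      conv_rhs => rw [h1, zpow_neg, zpow_natCast, inv_inv]
  have hsub : s ⊆ (nthRoots e.natAbs c').toFinset := fun α hα => by
    rw [Multiset.mem_toFinset, mem_nthRoots (Int.natAbs_pos.2 he)]
    exact hc' α hα
  exact (Finset.card_le_card hsub).trans
    ((Multiset.toFinset_card_le _).trans (card_nthRoots _ _))

theorem zpow_finset_sum {L ι : Type*} [Field L] {x : L} (hx : x ≠ 0) (s : Finset ι) (f : ι → ℤ) :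
    x ^ ∑ i ∈ s, f i = ∏ i ∈ s, x ^ f i := by
  classical
  induction s using Finset.induction_on with
  | empty => simp
  | insert i s hi ih => rw [Finset.sum_insert hi, Finset.prod_insert hi, zpow_add₀ hx, ih]

theorem IsDaggerIrreducible.exists_root {F : Type} [Field F] {σ : F →+* F} (L : Type*) [Field L]
    [Algebra F L] [IsAlgClosed L] {f : F[X]} (hf : IsDaggerIrreducible σ f) :
    ∃ α : L, aeval α f = 0 :=
  IsAlgClosed.exists_aeval_eq_zero L f (natDegree_pos_iff_degree_pos.1 hf.2.1).ne'

theorem IsDaggerSymm.exists_isDaggerIrreducible_dvd {F : Type} [Field F] {σ : F →+* F} {f : F[X]}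
    (hf : IsDaggerSymm σ f) (hm : f.Monic) (hdeg : 0 < f.natDegree) :
    ∃ g, IsDaggerIrreducible σ g ∧ g ∣ f := by
  classical
  have hex : ∃ k, ∃ g : F[X], g.Monic ∧ IsDaggerSymm σ g ∧ g ∣ f ∧ 0 < g.natDegree ∧
      g.natDegree = k := ⟨_, f, hm, hf, dvd_rfl, hdeg, rfl⟩
  obtain ⟨g, h1, h2, h3, h4, h5⟩ := Nat.find_spec hex
  refine ⟨g, ⟨h1, h4, h2, fun g' h1' h2' h3' h4' hlt => ?_⟩, h3⟩
  exact Nat.find_min hex (h5 ▸ hlt) ⟨g', h1', h2', h3'.trans h3, h4', rfl⟩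

section Counting

variable {F : Type} [Field F] [Fintype F] {σ : F →+* F} {L : Type*} [Field L] [Algebra F L]
  [IsAlgClosed L] {q : ℕ} {τ : L →+* L}

theorem natDegree_mul_card_le_natAbs (hq : Fintype.card F = q ^ 2)
    (hσ : ∀ x, σ x = x ^ q) (hτ : ∀ x, τ x = x ^ q) (s : Finset F[X]) {k : ℕ}
    (hs : ∀ f ∈ s, IsDaggerIrreducible σ f ∧ f.natDegree = k) {e : ℤ} (he : e ≠ 0) (c : L)
    (hc : ∀ f ∈ s, ∀ α : L, aeval α f = 0 → α ^ e = c) : k * s.card ≤ e.natAbs := by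
  classical
  have hroots : ∀ f ∈ s, ∀ α : L, α ∈ (f.map (algebraMap F L)).roots.toFinset ↔ aeval α f = 0 :=
    fun f hf α => by
      rw [Multiset.mem_toFinset, mem_roots ((hs f hf).1.1.map _).ne_zero, IsRoot.def,
        eval_map_algebraMap]
  have hcard : ∀ f ∈ s, (f.map (algebraMap F L)).roots.toFinset.card = k := fun f hf => by
    obtain ⟨α, hα⟩ := (hs f hf).1.exists_root L
    obtain ⟨-, -, h1, h2⟩ := (hs f hf).1.map_eq_prod_iterate hq hσ hτ hα
    rw [h2, ← Finset.prod_image (f := fun x => (X - C x : Polynomial L)) h1, roots_prod_X_sub_C,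
      Finset.val_toFinset, Finset.card_image_of_injOn h1, Finset.card_range, (hs f hf).2]
  have hdisj : (s : Set F[X]).PairwiseDisjoint
      fun f => (f.map (algebraMap F L)).roots.toFinset := by
    intro f hf g hg hfg
    refine Finset.disjoint_left.2 fun α hα hα' => hfg ?_
    exact (hs f hf).1.eq_of_aeval_eq_zero hq hσ hτ (hs g hg).1 ((hroots f hf α).1 hα)
      ((hroots g hg α).1 hα')
  have h := card_le_natAbs_of_zpow_eq
    (s.biUnion fun f => (f.map (algebraMap F L)).roots.toFinset) he c fun α hα => by
      obtain ⟨f, hf, hα⟩ := Finset.mem_biUnion.1 hα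
      exact hc f hf α ((hroots f hf α).1 hα)
  rwa [Finset.card_biUnion hdisj, Finset.sum_congr rfl hcard, Finset.sum_const, smul_eq_mul,
    mul_comm] at h

theorem natAbs_neg_pow_sub_one_le (q k : ℕ) : ((-(q : ℤ)) ^ k - 1).natAbs ≤ q ^ k + 1 := by
  refine (Int.natAbs_sub_le _ _).trans ?_
  simp [Int.natAbs_pow]

theorem neg_pow_sub_one_ne_zero {q k : ℕ} (hq : 2 ≤ q) (hk : 1 ≤ k) : (-(q : ℤ)) ^ k - 1 ≠ 0 := by
  intro h
  have h1 := congrArg Int.natAbs (sub_eq_zero.1 h)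
  rw [Int.natAbs_pow, Int.natAbs_neg, Int.natAbs_natCast, Int.natAbs_one] at h1
  exact (Nat.one_lt_pow (by omega) (by omega : 1 < q)).ne' h1

/-- The number of †-irreducible polynomials of degree `k` is at most `(q ^ k + 1) / k`. -/
theorem natDegree_mul_card_le_pow_add_one (hq2 : 2 ≤ q) (hq : Fintype.card F = q ^ 2)
    (hσ : ∀ x, σ x = x ^ q) (hτ : ∀ x, τ x = x ^ q) (s : Finset F[X]) {k : ℕ} (hk : 1 ≤ k)
    (hs : ∀ f ∈ s, IsDaggerIrreducible σ f ∧ f.natDegree = k) : k * s.card ≤ q ^ k + 1 := by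
  refine (natDegree_mul_card_le_natAbs hq hσ hτ s hs (neg_pow_sub_one_ne_zero hq2 hk) 1
    fun f hf α hα => ?_).trans (natAbs_neg_pow_sub_one_le q k)
  obtain ⟨h0, h1, -, -⟩ := (hs f hf).1.map_eq_prod_iterate hq hσ hτ hα
  rw [(hs f hf).2, twistedFrob_iterate] at h1
  rw [zpow_sub₀ h0, h1, zpow_one, div_self h0]

/-- The number of †-irreducible polynomials of degree `k` with a given constant coefficient is at
most `q ^ (k - 1) / k`. -/
theorem natDegree_mul_card_coeff_zero_le (hq2 : 2 ≤ q) (hq : Fintype.card F = q ^ 2)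
    (hσ : ∀ x, σ x = x ^ q) (hτ : ∀ x, τ x = x ^ q) (s : Finset F[X]) {k : ℕ} (hk : 1 ≤ k) (b : F)
    (hs : ∀ f ∈ s, (IsDaggerIrreducible σ f ∧ f.natDegree = k) ∧ f.coeff 0 = b) :
    k * s.card ≤ q ^ (k - 1) := by
  set e : ℤ := ∑ i ∈ Finset.range k, (-(q : ℤ)) ^ i with he
  have hmul : e * (-(q : ℤ) - 1) = (-(q : ℤ)) ^ k - 1 := geom_sum_mul _ _
  have he0 : e ≠ 0 := fun h => neg_pow_sub_one_ne_zero hq2 hk (by rw [← hmul, h, zero_mul])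
  have hle : e.natAbs ≤ q ^ (k - 1) := by
    have h1 := congrArg Int.natAbs hmul
    have h2 := natAbs_neg_pow_sub_one_le q k
    rw [Int.natAbs_mul, show (-(q : ℤ) - 1).natAbs = q + 1 by omega] at h1
    obtain ⟨l, rfl⟩ : ∃ l, k = l + 1 := ⟨k - 1, by omega⟩
    have h3 : 1 ≤ q ^ l := Nat.one_le_pow _ _ (by omega)
    rw [← h1, pow_succ] at h2
    rw [Nat.add_sub_cancel]
    by_contra! h4
    nlinarith
  refine (natDegree_mul_card_le_natAbs hq hσ hτ s (fun f hf => (hs f hf).1) he0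
    ((-1) ^ k * algebraMap F L b) fun f hf α hα => ?_).trans hle
  obtain ⟨h0, -, -, h1⟩ := (hs f hf).1.1.map_eq_prod_iterate hq hσ hτ hα
  have h2 := congrArg (fun p => coeff p 0) h1
  simp only [coeff_map, (hs f hf).2, coeff_zero_prod, coeff_sub, coeff_X_zero, coeff_C_zero,
    zero_sub, twistedFrob_iterate, (hs f hf).1.2] at h2
  rw [h2, Finset.prod_neg, Finset.card_range, ← mul_assoc, ← mul_pow, neg_one_mul, neg_neg,
    one_pow, one_mul, he, zpow_finset_sum h0]

/-- A squarefree †-symmetric polynomial is the product of its †-irreducible divisors. -/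
theorem IsDaggerSymm.prod_isDaggerIrreducible_eq (hq : Fintype.card F = q ^ 2)
    (hσ : ∀ x, σ x = x ^ q) (hτ : ∀ x : L, τ x = x ^ q) {f : F[X]} (hf : IsDaggerSymm σ f)
    (hm : f.Monic) (hsq : Squarefree f) (s : Finset F[X])
    (hs : ∀ g, g ∈ s ↔ IsDaggerIrreducible σ g ∧ g ∣ f) : ∏ g ∈ s, g = f := by
  have hdvd : ∏ g ∈ s, g ∣ f := by
    refine Finset.prod_dvd_of_coprime (fun g hg g' hg' hne => ?_) fun g hg => ((hs g).1 hg).2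
    refine (isCoprime_iff_aeval_ne_zero_of_isAlgClosed F L g g').2 fun α => ?_
    by_contra! h
    exact hne (((hs g).1 hg).1.eq_of_aeval_eq_zero hq hσ hτ ((hs g').1 hg').1 h.1 h.2)
  obtain ⟨h, hh⟩ := hdvd
  have hPm : (∏ g ∈ s, g).Monic := monic_prod_of_monic _ _ fun g hg => ((hs g).1 hg).1.1
  have hPs : IsDaggerSymm σ (∏ g ∈ s, g) :=
    IsDaggerSymm.prod s _ fun g hg => ((hs g).1 hg).1.2.2.1
  have hhm : h.Monic := hPm.of_mul_monic_left (hh ▸ hm)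
  have hhs : IsDaggerSymm σ h := hPs.of_mul_left (hh ▸ hf)
  rcases Nat.eq_zero_or_pos h.natDegree with h0 | h0
  · rw [hh, hhm.natDegree_eq_zero.1 h0, mul_one]
  · obtain ⟨g, hg, hgh⟩ := hhs.exists_isDaggerIrreducible_dvd hhm h0
    have hgs : g ∈ s := (hs g).2 ⟨hg, hh ▸ hgh.mul_left _⟩
    have hu := hsq g (hh ▸ mul_dvd_mul (Finset.dvd_prod_of_mem _ hgs) hgh)
    exact absurd (natDegree_eq_zero_of_isUnit hu) hg.2.1.ne'

end Counting

/-- `∑ q ^ (-deg g)` over the †-irreducible polynomials of degree at most `n` is `≤ log n + 2`. -/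
theorem sum_inv_pow_natDegree_le {F : Type} [Field F] [Fintype F] {σ : F →+* F} {L : Type*}
    [Field L] [Algebra F L] [IsAlgClosed L] {q : ℕ} {τ : L →+* L} (hq2 : 2 ≤ q)
    (hq : Fintype.card F = q ^ 2) (hσ : ∀ x, σ x = x ^ q) (hτ : ∀ x, τ x = x ^ q)
    (s : Finset F[X]) (n : ℕ) (hs : ∀ f ∈ s, IsDaggerIrreducible σ f ∧ f.natDegree ≤ n) :
    ∑ g ∈ s, ((q : ℝ) ^ g.natDegree)⁻¹ ≤ 2 + Real.log n := by
  have hq0 : (0 : ℝ) < q := by exact_mod_cast (by omega : 0 < q)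
  have hmaps : ∀ g ∈ s, g.natDegree ∈ Finset.Icc 1 n := fun g hg =>
    Finset.mem_Icc.2 ⟨(hs g hg).1.2.1, (hs g hg).2⟩
  have hterm : ∀ k ∈ Finset.Icc 1 n, ∑ g ∈ s with g.natDegree = k, ((q : ℝ) ^ g.natDegree)⁻¹ ≤
      (k : ℝ)⁻¹ + (1 / 2) ^ k := by
    intro k hk
    have hk1 : 1 ≤ k := (Finset.mem_Icc.1 hk).1
    have hk0 : (1 : ℝ) ≤ k := by exact_mod_cast hk1
    have hcount := natDegree_mul_card_le_pow_add_one hq2 hq hσ hτ (s.filter fun g => g.natDegree = k)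
      hk1 fun f hf => ⟨(hs f (Finset.mem_filter.1 hf).1).1, (Finset.mem_filter.1 hf).2⟩
    have hcount' : (k : ℝ) * (s.filter fun g => g.natDegree = k).card ≤ (q : ℝ) ^ k + 1 := by
      exact_mod_cast hcount
    have h2q : (2 : ℝ) ^ k ≤ (q : ℝ) ^ k :=
      pow_le_pow_left₀ (by norm_num) (by exact_mod_cast hq2) k
    have hqk : (0 : ℝ) < (q : ℝ) ^ k := by positivity
    calc ∑ g ∈ s with g.natDegree = k, ((q : ℝ) ^ g.natDegree)⁻¹
        = (s.filter fun g => g.natDegree = k).card * ((q : ℝ) ^ k)⁻¹ := by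
          rw [Finset.sum_congr rfl fun g hg => by rw [(Finset.mem_filter.1 hg).2],
            Finset.sum_const, nsmul_eq_mul]
      _ ≤ ((q : ℝ) ^ k + 1) / k * ((q : ℝ) ^ k)⁻¹ := by
          refine mul_le_mul_of_nonneg_right ?_ (by positivity)
          rw [le_div_iff₀ (by linarith), mul_comm]
          exact hcount'
      _ = (k : ℝ)⁻¹ + (k : ℝ)⁻¹ * ((q : ℝ) ^ k)⁻¹ := by field_simp
      _ ≤ (k : ℝ)⁻¹ + 1 * (1 / 2) ^ k := by
          gcongr
          · exact inv_le_one_of_one_le₀ hk0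
          · rw [one_div, inv_pow]
            exact inv_anti₀ (by positivity) h2q
      _ = _ := by rw [one_mul]
  have hharm : ∑ k ∈ Finset.Icc 1 n, (k : ℝ)⁻¹ ≤ 1 + Real.log n := by
    have h := harmonic_le_one_add_log n
    rw [harmonic_eq_sum_Icc] at h
    push_cast at h
    exact h
  have hgeom : ∑ k ∈ Finset.Icc 1 n, (1 / 2 : ℝ) ^ k ≤ 1 := by
    have h : ∀ N : ℕ, ∑ k ∈ Finset.Icc 1 N, (1 / 2 : ℝ) ^ k = 1 - (1 / 2) ^ N := by
      intro N
      induction N with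
      | zero => simp
      | succ N ih => rw [Finset.sum_Icc_succ_top (by omega), ih, pow_succ]; ring
    rw [h]
    linarith [show (0 : ℝ) ≤ (1 / 2) ^ n by positivity]
  rw [← Finset.sum_fiberwise_of_maps_to hmaps]
  refine (Finset.sum_le_sum hterm).trans ?_
  rw [Finset.sum_add_distrib]
  linarith

theorem exists_ringHom_eq_pow {F : Type*} [Field F] [Fintype F] (L : Type*) [Field L] [Algebra F L]
    {q : ℕ} (hq : Fintype.card F = q ^ 2) : ∃ τ : L →+* L, ∀ x, τ x = x ^ q := by
  obtain ⟨p, hchar, n, hp, hcard⟩ := FiniteField.card' F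
  have hdvd : q ∣ p ^ (n : ℕ) := by rw [← hcard, hq]; exact Dvd.intro_left q (sq q).symm
  obtain ⟨e, -, rfl⟩ := (Nat.dvd_prime_pow hp).1 hdvd
  have : CharP L p := charP_of_injective_algebraMap (algebraMap F L).injective p
  have : ExpChar L p := ExpChar.prime hp
  exact ⟨iterateFrobenius L p e, fun x => iterateFrobenius_def p e x⟩

theorem finite_setOf_natDegree_le (F : Type*) [Semiring F] [Finite F] (n : ℕ) :
    {f : F[X] | f.natDegree ≤ n}.Finite := by
  refine Set.Finite.of_injOn (f := fun (f : F[X]) (i : Fin (n + 1)) => f.coeff i)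
    (t := Set.univ) (fun _ _ => Set.mem_univ _) (fun f hf g hg h => ?_) Set.finite_univ
  ext i
  by_cases hi : i ≤ n
  · exact congrFun h ⟨i, Nat.lt_succ_of_le hi⟩
  · rw [coeff_eq_zero_of_natDegree_lt (lt_of_le_of_lt hf (not_le.1 hi)),
      coeff_eq_zero_of_natDegree_lt (lt_of_le_of_lt hg (not_le.1 hi))]

/-- **Poisson-type tail bound, †-symmetric case.**
Over a field with `q0²` elements with involution `x ↦ x^{q0}`: for any partition `I_1, …, I_r`
of the (monic) †-irreducible polynomials of degree `≤ n`, and any `m_1, …, m_r ≥ 0` (with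
`m_i = 0` when `I_i = ∅`), the number of squarefree †-symmetric monic `f` of degree `n` with
constant coefficient `a ∈ U` having exactly `m_i` distinct †-irreducible factors in `I_i` for
each `i` is `≤ C q0ⁿ⁻¹ ∏_i (e^{-H†(I_i)} H†(I_i)^{m_i}/m_i!) ⬝ (∑_i m_i/H†(I_i))`. -/
theorem stmt5 : ∃ C : ℝ, 0 < C ∧
    ∀ (F : Type) [Field F] [Fintype F], ∀ (q0 n r : ℕ) (σ : F →+* F) (a : F),
      IsPrimePow q0 → Fintype.card F = q0 ^ 2 → (∀ x : F, σ x = x ^ q0) →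
      1 ≤ n → a ^ (q0 + 1) = 1 →
      ∀ I : Fin r → Set F[X],
        (∀ i j, i ≠ j → Disjoint (I i) (I j)) →
        (⋃ i, I i) = {g : F[X] | IsDaggerIrreducible σ g ∧ g.natDegree ≤ n} →
      ∀ m : Fin r → ℕ, (∀ i, I i = ∅ → m i = 0) →
        ({f : F[X] | f.Monic ∧ Squarefree f ∧ IsDaggerSymm σ f ∧ f.natDegree = n ∧
            f.coeff 0 = a ∧ ∀ i, {g ∈ I i | g ∣ f}.ncard = m i}.ncard : ℝ) ≤
          C * (q0 : ℝ) ^ (n - 1) *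
            (∏ i : Fin r, Real.exp (-(polyHdagger q0 (I i))) * (polyHdagger q0 (I i)) ^ (m i) /
              (Nat.factorial (m i) : ℝ)) *
            (∑ i : Fin r, (m i : ℝ) / polyHdagger q0 (I i)) := by
  refine ⟨Real.exp 2, Real.exp_pos 2, ?_⟩
  intro F _ _ q n r σ a _ hq hσ hn _ I hdisj hunion m _
  classical
  obtain ⟨τ, hτ⟩ := exists_ringHom_eq_pow (AlgebraicClosure F) hq
  have hq2 : 2 ≤ q := by
    by_contra! h
    have h1 : 1 < q ^ 2 := hq ▸ Fintype.one_lt_card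
    interval_cases q <;> simp at h1
  have hmemI : ∀ i, ∀ g ∈ I i, IsDaggerIrreducible σ g ∧ g.natDegree ≤ n := fun i g hg => by
    have : g ∈ ⋃ i, I i := Set.mem_iUnion.2 ⟨i, hg⟩
    rwa [hunion] at this
  have hfin : ∀ i, (I i).Finite := fun i =>
    (finite_setOf_natDegree_le F n).subset fun g hg => (hmemI i g hg).2
  set J : Fin r → Finset F[X] := fun i => (hfin i).toFinset with hJ
  have hmemJ : ∀ i g, g ∈ J i ↔ g ∈ I i := fun i g => (hfin i).mem_toFinset
  have hH : ∀ i, polyHdagger q (I i) = ∑ g ∈ J i, ((q : ℝ) ^ g.natDegree)⁻¹ := fun i =>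
    finsum_mem_eq_finite_toFinset_sum _ (hfin i)
  have hJdisj : ∀ i j, i ≠ j → Disjoint (J i) (J j) := fun i j hij =>
    Finset.disjoint_left.2 fun g hgi hgj =>
      Set.disjoint_left.1 (hdisj i j hij) ((hmemJ i g).1 hgi) ((hmemJ j g).1 hgj)
  have hHpos : ∀ i, 0 ≤ polyHdagger q (I i) := fun i => by
    rw [hH]
    exact Finset.sum_nonneg fun g _ => by positivity
  have hHsum : ∑ i, polyHdagger q (I i) ≤ 2 + Real.log n := by
    rw [Finset.sum_congr rfl fun i _ => hH i,
      ← Finset.sum_biUnion fun i _ j _ hij => hJdisj i j hij]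
    refine sum_inv_pow_natDegree_le hq2 hq hσ hτ _ n fun f hf => ?_
    obtain ⟨i, -, hi⟩ := Finset.mem_biUnion.1 hf
    exact hmemI i f ((hmemJ i f).1 hi)
  set A := (subsetTuples J m).filter
    (fun T => ∑ j, ∑ g ∈ T j, g.natDegree = n ∧ ∏ j, ∏ g ∈ T j, g.coeff 0 = a) with hA
  have hcard := card_subsetTuples_le (q := q) (by omega) J m natDegree (fun g => g.coeff 0)
    (fun g ⟨i, hi⟩ => (hmemI i g ((hmemJ i g).1 hi)).1.2.2.1.1)
    (fun i k b hk => natDegree_mul_card_coeff_zero_le hq2 hq hσ hτ _ hk b fun f hf => by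
      simp only [Finset.mem_filter, hmemJ] at hf
      exact ⟨⟨(hmemI i f hf.1).1, hf.2.1⟩, hf.2.2⟩) n a
  rw [← hA] at hcard
  simp only [← hH] at hcard
  set N := {f : F[X] | f.Monic ∧ Squarefree f ∧ IsDaggerSymm σ f ∧ f.natDegree = n ∧
    f.coeff 0 = a ∧ ∀ i, {g ∈ I i | g ∣ f}.ncard = m i} with hN
  let Φ : F[X] → Fin r → Finset F[X] := fun f i => (J i).filter (· ∣ f)
  have hprod : ∀ f ∈ N, ∏ j, ∏ g ∈ Φ f j, g = f := by
    intro f hf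
    obtain ⟨hfm, hfsq, hfs, hfd, -, -⟩ := hf
    rw [← Finset.prod_biUnion fun i _ j _ hij =>
      Finset.disjoint_filter_filter (hJdisj i j hij)]
    refine hfs.prod_isDaggerIrreducible_eq hq hσ hτ hfm hfsq _ fun g => ?_
    simp only [Finset.mem_biUnion, Finset.mem_univ, true_and, Finset.mem_filter, hmemJ]
    constructor
    · rintro ⟨i, hi, hg⟩
      exact ⟨(hmemI i g hi).1, hg⟩
    · rintro ⟨hg, hgf⟩
      have hgI : g ∈ ⋃ i, I i := by
        rw [hunion]
        exact ⟨hg, hfd ▸ natDegree_le_of_dvd hgf hfm.ne_zero⟩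
      obtain ⟨i, hi⟩ := Set.mem_iUnion.1 hgI
      exact ⟨i, hi, hgf⟩
  have hΦ : Set.MapsTo Φ N A := by
    intro f hf
    have hpf := hprod f hf
    obtain ⟨-, -, -, hfd, hfa, hfm⟩ := hf
    have hmon : ∀ j, ∀ g ∈ Φ f j, g.Monic := fun j g hg =>
      (hmemI j g ((hmemJ j g).1 (Finset.mem_filter.1 hg).1)).1.1
    rw [Finset.mem_coe, hA, Finset.mem_filter, Fintype.mem_piFinset]
    refine ⟨fun j => Finset.mem_powersetCard.2 ⟨Finset.filter_subset _ _, ?_⟩, ?_, ?_⟩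
    · rw [← hfm j, ← Set.ncard_coe_finset]
      congr 1
      ext g
      simp [Φ, hmemJ]
    · rw [← hfd]
      conv_rhs => rw [← hpf]
      rw [natDegree_prod_of_monic _ _ fun j _ => monic_prod_of_monic _ _ (hmon j)]
      exact Finset.sum_congr rfl fun j _ => (natDegree_prod_of_monic _ _ (hmon j)).symm
    · rw [← hfa]
      conv_rhs => rw [← hpf]
      rw [coeff_zero_prod]
      exact Finset.prod_congr rfl fun j _ => (coeff_zero_prod _ _).symm
  have hinj : Set.InjOn Φ N := fun f hf g hg h => by
    rw [← hprod f hf, ← hprod g hg, h]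
  have hNA : (N.ncard : ℝ) ≤ A.card := by
    rw [← Set.ncard_coe_finset]
    exact_mod_cast Set.ncard_le_ncard_of_injOn Φ hΦ hinj A.finite_toSet
  set P := ∏ j, (polyHdagger q (I j) ^ m j / ((m j).factorial : ℝ)) with hP
  set S := ∑ i, (m i : ℝ) / polyHdagger q (I i) with hS
  have hX : 0 ≤ (q : ℝ) ^ (n - 1) * P * S := by
    refine mul_nonneg (mul_nonneg (by positivity) (Finset.prod_nonneg fun j _ => ?_))
      (Finset.sum_nonneg fun j _ => ?_)
    · exact div_nonneg (pow_nonneg (hHpos j) _) (by positivity)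
    · exact div_nonneg (by positivity) (hHpos j)
  have hexp : ∏ i, Real.exp (-(polyHdagger q (I i))) * polyHdagger q (I i) ^ m i /
      ((m i).factorial : ℝ) = Real.exp (-∑ i, polyHdagger q (I i)) * P := by
    rw [hP, ← Finset.sum_neg_distrib, Real.exp_sum, ← Finset.prod_mul_distrib]
    exact Finset.prod_congr rfl fun i _ => mul_div_assoc _ _ _
  have hn0 : (0 : ℝ) < n := by exact_mod_cast hn
  have hlog : (n : ℝ)⁻¹ ≤ Real.exp 2 * Real.exp (-∑ i, polyHdagger q (I i)) := by
    rw [← Real.exp_add, ← Real.exp_log (inv_pos.2 hn0), Real.log_inv, Real.exp_le_exp]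
    linarith
  rw [hexp]
  calc (N.ncard : ℝ) ≤ A.card := hNA
    _ ≤ (n : ℝ)⁻¹ * ((q : ℝ) ^ (n - 1) * P * S) := by
        rw [← div_eq_inv_mul, le_div_iff₀ hn0, mul_comm]
        exact hcard
    _ ≤ Real.exp 2 * Real.exp (-∑ i, polyHdagger q (I i)) * ((q : ℝ) ^ (n - 1) * P * S) :=
        mul_le_mul_of_nonneg_right hlog hX
    _ = _ := by ring
end

section
/- Let δ = 1 − (1 + log log 2)/log 2 (≈ 0.086). There is an absolute constant C > 0 with the following property. Let F be a finite field with q elements, let n ≥ 2, let 1 ≤ k ≤ n/2, and let a ∈ F^×. Then the number of monic polynomials f of degree n over F with constant coefficient a that have a monic divisor of degree k is at most C·q^{n−1}·k^{−δ}·(1 + log k)^{−1/2}. -/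
open Polynomial

/-- The Ford constant `δ = 1 - (1 + log log 2)/log 2 ≈ 0.086`. -/
noncomputable def fordDelta : ℝ := 1 - (1 + Real.log (Real.log 2)) / Real.log 2

open Finset in
theorem sum_Ico_pow_div_factorial_le {x : ℝ} (hx : 0 ≤ x) {J : ℕ} (h : x ≤ 3 / 4 * (J + 1))
    {n : ℕ} (hn : J ≤ n) :
    ∑ j ∈ Ico J n, x ^ j / j.factorial ≤
      4 * (x ^ J / J.factorial - x ^ n / n.factorial) := by
  induction n, hn using Nat.le_induction with
  | base => simp
  | succ n hn ih =>
    rw [sum_Ico_succ_top hn]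
    have h1 : x ^ (n + 1) / (n + 1).factorial = x / (n + 1) * (x ^ n / n.factorial) := by
      rw [Nat.factorial_succ, pow_succ]
      push_cast
      field_simp
    have h2 : x / (n + 1) ≤ 3 / 4 := by
      rw [div_le_iff₀ (by positivity)]
      have : (J : ℝ) ≤ n := by exact_mod_cast hn
      linarith
    have h3 : 0 ≤ x ^ n / n.factorial := by positivity
    rw [h1]
    nlinarith [mul_le_mul_of_nonneg_right h2 h3]

open Finset in
theorem sum_range_pow_div_factorial_le {x : ℝ} {J : ℕ} (h : J ≤ 3 / 4 * x) :
    ∑ j ∈ range (J + 1), x ^ j / j.factorial ≤ 4 * (x ^ J / J.factorial) := by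
  induction J with
  | zero => simp
  | succ J ih =>
    push_cast at h
    have hJ : (0 : ℝ) ≤ J := J.cast_nonneg
    have hx : 0 < x := by linarith
    rw [sum_range_succ]
    have h1 : x ^ J / J.factorial = (J + 1) / x * (x ^ (J + 1) / (J + 1).factorial) := by
      rw [Nat.factorial_succ, pow_succ]
      push_cast
      field_simp
    have h2 : (J + 1) / x ≤ 3 / 4 := by
      rw [div_le_iff₀ hx]
      linarith
    have h3 : 0 ≤ x ^ (J + 1) / (J + 1).factorial := by positivity
    have h4 := ih (by linarith)
    rw [h1] at h4
    nlinarith [mul_le_mul_of_nonneg_right h2 h3]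

theorem one_lt_inv_log_two_mul {x : ℝ} (hx : 0 ≤ x) :
    4 / 3 * x ≤ x / Real.log 2 ∧ x / Real.log 2 ≤ 3 / 2 * x := by
  have h1 := Real.log_two_gt_d9
  have h2 := Real.log_two_lt_d9
  constructor
  · rw [le_div_iff₀ (by linarith)]
    nlinarith
  · rw [div_le_iff₀ (by linarith)]
    nlinarith

theorem mul_one_sub_fordDelta (x : ℝ) :
    x * (1 - fordDelta) = x / Real.log 2 * (1 + Real.log (Real.log 2)) := by
  unfold fordDelta
  ring

/-- Stirling's formula at the critical number of prime factors. -/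
theorem pow_div_factorial_ceil_le {x : ℝ} (hx : 1 ≤ x) :
    x ^ ⌈x / Real.log 2⌉₊ / (⌈x / Real.log 2⌉₊).factorial ≤
      Real.exp (x * (1 - fordDelta)) * x ^ (-(1 / 2) : ℝ) := by
  set J := ⌈x / Real.log 2⌉₊ with hJ
  have hl := Real.log_two_gt_d9
  have hl2 := Real.log_two_lt_d9
  have hl0 : 0 < Real.log 2 := by linarith
  have ht0 : 0 < x / Real.log 2 := by positivity
  have hJt : x / Real.log 2 ≤ J := Nat.le_ceil _
  have hJ0 : (0 : ℝ) < J := ht0.trans_le hJt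
  have hxJ : x ≤ J := by
    have := (one_lt_inv_log_two_mul (by linarith : 0 ≤ x)).1
    linarith
  have hst := Stirling.le_factorial_stirling J
  have hsq : x ^ (1 / 2 : ℝ) ≤ √(2 * Real.pi * J) := by
    rw [← Real.sqrt_eq_rpow]
    apply Real.sqrt_le_sqrt
    nlinarith [Real.pi_gt_three]
  have hpow : x ^ J ≤ Real.exp (x * (1 - fordDelta)) * (J / Real.exp 1) ^ J := by
    have e1 : x ^ J = Real.exp (J * Real.log x) := by
      rw [mul_comm, Real.exp_mul, Real.exp_log (by linarith), Real.rpow_natCast]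
    have e2 : (J / Real.exp 1) ^ J = Real.exp (J * (Real.log J - 1)) := by
      rw [mul_comm, Real.exp_mul, Real.exp_sub, Real.exp_log hJ0, Real.rpow_natCast]
    rw [e1, e2, ← Real.exp_add]
    apply Real.exp_le_exp.2
    rw [mul_one_sub_fordDelta]
    have hlog : Real.log (x / Real.log 2) + 1 - (x / Real.log 2) / J ≤ Real.log J := by
      have := Real.log_le_sub_one_of_pos (div_pos ht0 hJ0)
      rw [Real.log_div ht0.ne' hJ0.ne'] at this
      linarith
    have hlx : Real.log (x / Real.log 2) = Real.log x - Real.log (Real.log 2) :=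
      Real.log_div (by linarith) hl0.ne'
    have hneg : Real.log (Real.log 2) ≤ 0 := Real.log_nonpos hl0.le (by linarith)
    have := mul_le_mul_of_nonneg_left hlog hJ0.le
    rw [mul_sub, mul_div_cancel₀ _ hJ0.ne', hlx] at this
    nlinarith [mul_nonneg (sub_nonneg.2 hJt) (neg_nonneg.2 hneg)]
  rw [div_le_iff₀ (by positivity)]
  have hx0 : 0 < x := by linarith
  calc x ^ J ≤ Real.exp (x * (1 - fordDelta)) * (J / Real.exp 1) ^ J := hpow
    _ = Real.exp (x * (1 - fordDelta)) * x ^ (-(1 / 2) : ℝ) *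
        (x ^ (1 / 2 : ℝ) * (J / Real.exp 1) ^ J) := by
        rw [Real.rpow_neg hx0.le]
        field_simp
    _ ≤ _ := by
        gcongr
        exact (mul_le_mul_of_nonneg_right hsq (by positivity)).trans hst

theorem exp_mul_one_sub_fordDelta {k : ℝ} (hk : 1 ≤ k) :
    Real.exp ((1 + Real.log k) * (1 - fordDelta)) =
      Real.exp (1 - fordDelta) * (k * k ^ (-fordDelta)) := by
  have hk0 : 0 < k := by linarith
  rw [Real.rpow_def_of_pos hk0]
  nth_rewrite 2 [← Real.exp_log hk0]
  rw [← Real.exp_add, ← Real.exp_add]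
  congr 1
  ring

open Finset in
/-- The contribution of polynomials with many small prime factors. -/
theorem sum_Ico_ceil_le {k : ℝ} (hk : 1 ≤ k) (n : ℕ) :
    ∑ j ∈ Ico ⌈(1 + Real.log k) / Real.log 2⌉₊ n, (1 + Real.log k) ^ j / j.factorial ≤
      4 * Real.exp (1 - fordDelta) * (k * k ^ (-fordDelta) *
        (1 + Real.log k) ^ (-(1 / 2) : ℝ)) := by
  have hL := Real.log_nonneg hk
  set x := 1 + Real.log k with hx
  have hx1 : 1 ≤ x := by linarith
  have hmain := pow_div_factorial_ceil_le hx1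
  rw [hx, exp_mul_one_sub_fordDelta hk, ← hx] at hmain
  set J := ⌈x / Real.log 2⌉₊ with hJ
  rcases le_or_gt J n with h | h
  · have hJt : x / Real.log 2 ≤ J := Nat.le_ceil _
    have := (one_lt_inv_log_two_mul (by linarith : 0 ≤ x)).1
    have h1 := sum_Ico_pow_div_factorial_le (by linarith : 0 ≤ x)
      (by linarith : x ≤ 3 / 4 * (J + 1)) h
    have h2 : 0 ≤ x ^ n / n.factorial := by positivity
    linarith
  · rw [Ico_eq_empty (by omega)]
    simp only [sum_empty]
    positivity

open Finset in
/-- The contribution of factorizations with few small prime factors. -/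
theorem sum_range_ceil_le {k : ℝ} (hk : 1 ≤ k) :
    ∑ j ∈ range (⌈(1 + Real.log k) / Real.log 2⌉₊ + 1),
        (2 * (1 + Real.log k) + 2) ^ j / j.factorial ≤
      8 * Real.exp 4 * Real.exp (1 - fordDelta) * k * (k * k ^ (-fordDelta) *
        (1 + Real.log k) ^ (-(1 / 2) : ℝ)) := by
  have hL := Real.log_nonneg hk
  have hk0 : 0 < k := by linarith
  have hkx : k * Real.exp 1 = Real.exp (1 + Real.log k) := by
    rw [Real.exp_add, Real.exp_log hk0, mul_comm]
  set x := 1 + Real.log k with hx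
  have hx1 : 1 ≤ x := by linarith
  have hmain := pow_div_factorial_ceil_le hx1
  rw [hx, exp_mul_one_sub_fordDelta hk, ← hx] at hmain
  have hb := (one_lt_inv_log_two_mul (by linarith : 0 ≤ x)).2
  have hl0 : 0 < Real.log 2 := Real.log_pos (by norm_num)
  have hJu : (⌈x / Real.log 2⌉₊ : ℝ) < x / Real.log 2 + 1 := Nat.ceil_lt_add_one (by positivity)
  set J := ⌈x / Real.log 2⌉₊ with hJ
  refine (sum_range_pow_div_factorial_le (by linarith)).trans ?_
  have h2 : (2 : ℝ) ^ J ≤ 2 * (k * Real.exp 1) := by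
    rw [hkx, ← Real.rpow_natCast]
    calc (2 : ℝ) ^ (J : ℝ) ≤ 2 ^ (x / Real.log 2 + 1) :=
          Real.rpow_le_rpow_of_exponent_le (by norm_num) hJu.le
      _ = 2 * Real.exp x := by
          rw [Real.rpow_add (by norm_num), Real.rpow_one, Real.rpow_def_of_pos (by norm_num),
            mul_div_cancel₀ _ hl0.ne', mul_comm]
  have h3 : (1 + 1 / x) ^ J ≤ Real.exp 3 := by
    calc (1 + 1 / x) ^ J ≤ Real.exp (1 / x) ^ J := by
          gcongr
          have := Real.add_one_le_exp (1 / x)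
          linarith
      _ = Real.exp (J * (1 / x)) := by rw [← Real.exp_nat_mul]
      _ ≤ Real.exp 3 := by
          apply Real.exp_le_exp.2
          rw [mul_one_div, div_le_iff₀ (by linarith)]
          linarith
  have h4 : (2 * x + 2) ^ J = 2 ^ J * (1 + 1 / x) ^ J * x ^ J := by
    rw [← mul_pow, ← mul_pow]
    congr 1
    field_simp
  rw [h4, mul_div_assoc]
  calc 4 * (2 ^ J * (1 + 1 / x) ^ J * (x ^ J / J.factorial))
      ≤ 4 * (2 * (k * Real.exp 1) * Real.exp 3 *
        (Real.exp (1 - fordDelta) * (k * k ^ (-fordDelta)) * x ^ (-(1 / 2) : ℝ))) := by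
        gcongr
    _ = _ := by
        rw [show (4 : ℝ) = 1 + 3 by norm_num, Real.exp_add]
        ring

section FiniteField

variable {F : Type*} [Field F]

theorem sum_natDegree_le_of_dvd {D : Finset F[X]} {P : F[X]} (hP : P ≠ 0)
    (hirr : ∀ p ∈ D, Irreducible p) (hmon : ∀ p ∈ D, p.Monic) (hdvd : ∀ p ∈ D, p ∣ P) :
    ∑ p ∈ D, p.natDegree ≤ P.natDegree := by
  rw [← natDegree_prod_of_monic _ _ hmon]
  refine natDegree_le_of_dvd (Finset.prod_dvd_of_coprime (fun p hp r hr hne => ?_) hdvd) hP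
  refine (hirr p hp).coprime_iff_not_dvd.2 fun h => hne ?_
  exact eq_of_monic_of_associated (hmon p hp) (hmon r hr)
    ((hirr p hp).associated_of_dvd (hirr r hr) h)

variable [Fintype F]

theorem dvd_X_pow_geom_sum_sub {p : F[X]} (hirr : Irreducible p) (hmon : p.Monic) (i : ℕ) :
    p ∣ X ^ (∑ j ∈ Finset.range (p.natDegree * i), Fintype.card F ^ j) -
      C ((-1) ^ (p.natDegree * i) * p.coeff 0 ^ i) := by
  have : Fact (Irreducible p) := ⟨hirr⟩
  let pb := AdjoinRoot.powerBasis hirr.ne_zero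
  have : Module.Finite F (AdjoinRoot p) := pb.finite
  have : Finite (AdjoinRoot p) := Module.finite_of_finite F
  have hfr : Module.finrank F (AdjoinRoot p) = p.natDegree := by
    rw [pb.finrank, AdjoinRoot.powerBasis_dim]
  have hnorm : Algebra.norm F (AdjoinRoot.root p) = (-1) ^ p.natDegree * p.coeff 0 := by
    have := Algebra.PowerBasis.norm_gen_eq_coeff_zero_minpoly pb
    rw [AdjoinRoot.powerBasis_gen, AdjoinRoot.powerBasis_dim,
      AdjoinRoot.minpoly_root hirr.ne_zero, hmon.leadingCoeff, inv_one, C_1, mul_one] at this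
    exact this
  have hpow := FiniteField.algebraMap_norm_eq_pow_sum F (AdjoinRoot p) (x := AdjoinRoot.root p)
  rw [hnorm, hfr, Nat.card_eq_fintype_card] at hpow
  rw [← AdjoinRoot.mk_eq_zero, map_sub, map_pow, AdjoinRoot.mk_X, AdjoinRoot.mk_C, sub_eq_zero,
    ← AdjoinRoot.algebraMap_eq]
  have hsum : ∀ i : ℕ, AdjoinRoot.root p ^ (∑ j ∈ Finset.range (p.natDegree * i),
      Fintype.card F ^ j) = algebraMap F (AdjoinRoot p) (((-1) ^ p.natDegree * p.coeff 0) ^ i) := by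
    intro i
    induction i with
    | zero => simp
    | succ i ih =>
      have : ∑ j ∈ Finset.range p.natDegree, Fintype.card F ^ (p.natDegree * i + j) =
          (∑ j ∈ Finset.range p.natDegree, Fintype.card F ^ j) *
            Fintype.card F ^ (p.natDegree * i) := by
        rw [Finset.sum_mul]
        exact Finset.sum_congr rfl fun j _ => by rw [pow_add, mul_comm]
      rw [mul_add, mul_one, Finset.sum_range_add, pow_add, ih, this, pow_mul, ← hpow, ← map_pow,
        FiniteField.pow_card_pow, ← map_mul, pow_succ]
  rw [hsum, mul_pow, ← pow_mul]

theorem natDegree_X_pow_sub_C_geom {d : ℕ} (hd : d ≠ 0) (c : F) :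
    (X ^ (∑ j ∈ Finset.range d, Fintype.card F ^ j) - C c).natDegree =
      ∑ j ∈ Finset.range d, Fintype.card F ^ j ∧
    X ^ (∑ j ∈ Finset.range d, Fintype.card F ^ j) - C c ≠ 0 := by
  have : 0 < ∑ j ∈ Finset.range d, Fintype.card F ^ j :=
    Finset.sum_pos (fun j _ => pow_pos Fintype.card_pos j) (by simpa using hd)
  exact ⟨natDegree_X_pow_sub_C, X_pow_sub_C_ne_zero this c⟩

/-- The prime polynomial bound for prime powers with a prescribed constant coefficient. -/
theorem sum_natDegree_le_of_pow_coeff_zero {D : Finset F[X]} {d : ℕ} (hd : d ≠ 0) (c : F)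
    (hD : ∀ p ∈ D, Irreducible p ∧ p.Monic ∧ ∃ i, p.natDegree * i = d ∧ p.coeff 0 ^ i = c) :
    ∑ p ∈ D, p.natDegree ≤ 2 * Fintype.card F ^ (d - 1) := by
  obtain ⟨h1, h2⟩ := natDegree_X_pow_sub_C_geom hd ((-1) ^ d * c)
  refine (sum_natDegree_le_of_dvd h2 (fun p hp => (hD p hp).1) (fun p hp => (hD p hp).2.1)
    fun p hp => ?_).trans (h1.le.trans ?_)
  · obtain ⟨hi, hm, i, rfl, rfl⟩ := hD p hp
    exact dvd_X_pow_geom_sum_sub hi hm i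
  · obtain ⟨e, rfl⟩ := Nat.exists_eq_succ_of_ne_zero hd
    have hq : 2 ≤ Fintype.card F := Fintype.one_lt_card
    have h3 := Nat.geomSum_lt (m := Fintype.card F) (n := e) (s := Finset.range e) hq
      (fun k hk => Finset.mem_range.1 hk)
    simp only [Nat.succ_eq_add_one, Finset.sum_range_succ, Nat.add_sub_cancel]
    omega

/-- The prime polynomial bound, leaving out the polynomial `X`. -/
theorem card_mul_le_of_irreducible {D : Finset F[X]} {d : ℕ}
    (hD : ∀ p ∈ D, Irreducible p ∧ p.Monic ∧ p.coeff 0 ≠ 0 ∧ p.natDegree = d) :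
    D.card * d ≤ Fintype.card F ^ d - 1 := by
  have hq : 1 < Fintype.card F := Fintype.one_lt_card
  rcases D.eq_empty_or_nonempty with rfl | ⟨p₀, hp₀⟩
  · simp
  have hd : d ≠ 0 := by
    obtain ⟨h1, -, -, rfl⟩ := hD p₀ hp₀
    exact h1.natDegree_pos.ne'
  have hpos : 0 < Fintype.card F ^ d - 1 := Nat.sub_pos_of_lt (Nat.one_lt_pow hd hq)
  have hsum : ∑ p ∈ D, p.natDegree = D.card * d := by
    rw [Finset.sum_congr rfl fun p hp => (hD p hp).2.2.2, Finset.sum_const, smul_eq_mul]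
  rw [← hsum, ← natDegree_X_pow_sub_C (n := Fintype.card F ^ d - 1) (r := (1 : F))]
  refine sum_natDegree_le_of_dvd (X_pow_sub_C_ne_zero hpos 1) (fun p hp => (hD p hp).1)
    (fun p hp => (hD p hp).2.1) fun p hp => ?_
  obtain ⟨h1, h2, h3, rfl⟩ := hD p hp
  have hdvd := h1.natDegree_dvd_iff_dvd_X_pow_card_pow_sub_X.1 (dvd_refl _)
  rw [Nat.card_eq_fintype_card] at hdvd
  have hfac : (X ^ (Fintype.card F ^ p.natDegree) - X : F[X]) =
      X * (X ^ (Fintype.card F ^ p.natDegree - 1) - C 1) := by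
    rw [mul_sub, ← pow_succ', Nat.sub_add_cancel (by omega), C_1, mul_one]
  rw [hfac] at hdvd
  refine (h1.prime.dvd_or_dvd hdvd).resolve_left fun h => h3 ?_
  have := eq_of_monic_of_associated h2 monic_X (h1.associated_of_dvd irreducible_X h)
  simp [this]

end FiniteField

section MonicPolynomials

open Finset UniqueFactorizationMonoid
open scoped Classical

theorem sum_le_sum_of_injOn {ι κ : Type*} {s : Finset ι} {t : Finset κ} {f : ι → ℝ} {g : κ → ℝ}
    (e : ι → κ) (hmaps : ∀ x ∈ s, e x ∈ t) (hinj : Set.InjOn e s) (hle : ∀ x ∈ s, f x ≤ g (e x))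
    (hg : ∀ y ∈ t, 0 ≤ g y) : ∑ x ∈ s, f x ≤ ∑ y ∈ t, g y :=
  calc ∑ x ∈ s, f x ≤ ∑ x ∈ s, g (e x) := sum_le_sum hle
    _ = ∑ y ∈ s.image e, g y := (sum_image hinj).symm
    _ ≤ ∑ y ∈ t, g y :=
      sum_le_sum_of_subset_of_nonneg (image_subset_iff.2 hmaps) fun y hy _ => hg y hy

variable {F : Type*} [Field F]

theorem mem_primeFactors_iff {p f : F[X]} (hf : f ≠ 0) :
    p ∈ primeFactors f ↔ Irreducible p ∧ p.Monic ∧ p ∣ f := by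
  rw [mem_primeFactors, mem_normalizedFactors_iff' hf]
  refine ⟨fun ⟨h1, h2, h3⟩ => ⟨h1, ?_, h3⟩, fun ⟨h1, h2, h3⟩ => ⟨h1, h2.normalize_eq_self, h3⟩⟩
  rw [← h2]
  exact monic_normalize h1.ne_zero

/-- The prime powers dividing a monic polynomial, weighted by the von Mangoldt function, account
for its degree. -/
theorem exists_primePow_divisors {f : F[X]} (hf : f.Monic) :
    ∃ E : Finset (Σ _ : F[X], ℕ),
      (∀ x ∈ E, Irreducible x.1 ∧ x.1.Monic ∧ 1 ≤ x.2 ∧ x.1 ^ x.2 ∣ f) ∧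
        ∑ x ∈ E, x.1.natDegree = f.natDegree := by
  have hprod : (normalizedFactors f).prod = f := by
    rw [prod_normalizedFactors_eq hf.ne_zero, hf.normalize_eq_self]
  refine ⟨(primeFactors f).sigma fun p => Icc 1 ((normalizedFactors f).count p), ?_, ?_⟩
  · rintro ⟨p, i⟩ h
    rw [mem_sigma, mem_primeFactors_iff hf.ne_zero, mem_Icc] at h
    obtain ⟨⟨h1, h2, -⟩, h3, h4⟩ := h
    refine ⟨h1, h2, h3, ?_⟩
    have := Multiset.prod_dvd_prod_of_le (Multiset.le_count_iff_replicate_le.1 h4)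
    rwa [Multiset.prod_replicate, hprod] at this
  · rw [sum_sigma]
    have hmon : ∀ p ∈ normalizedFactors f, p.Monic := fun p hp =>
      ((mem_primeFactors_iff hf.ne_zero).1 (mem_primeFactors.2 hp)).2.1
    have := natDegree_multiset_prod_of_monic (normalizedFactors f) hmon
    rw [hprod, sum_multiset_map_count, toFinset_normalizedFactors] at this
    rw [this]
    exact sum_congr rfl fun p _ => by simp

variable [Fintype F]

theorem finite_monic_natDegree_lt (F : Type*) [Field F] [Fintype F] (n : ℕ) :
    {f : F[X] | f.Monic ∧ f.natDegree < n ∧ f.coeff 0 ≠ 0}.Finite := by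
  refine Set.Finite.of_injOn (f := fun f : F[X] => fun i : Fin n => f.coeff i)
    (t := Set.univ) (fun _ _ => Set.mem_univ _) ?_ Set.finite_univ
  rintro f ⟨-, hf, -⟩ g ⟨-, hg, -⟩ h
  ext i
  by_cases hi : i < n
  · exact congrFun h ⟨i, hi⟩
  · rw [coeff_eq_zero_of_natDegree_lt (by omega), coeff_eq_zero_of_natDegree_lt (by omega)]

/-- The monic polynomials of degree less than `n` that are not divisible by `X`. -/
noncomputable def monicsLT (F : Type*) [Field F] [Fintype F] (n : ℕ) : Finset F[X] :=
  (finite_monic_natDegree_lt F n).toFinset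

theorem mem_monicsLT {n : ℕ} {f : F[X]} :
    f ∈ monicsLT F n ↔ f.Monic ∧ f.natDegree < n ∧ f.coeff 0 ≠ 0 := by
  simp [monicsLT]

/-- If `p ^ i * f'` runs over monic polynomials of degree `n` with a given nonzero constant
coefficient, then the average over `p ^ i` saves a factor `n`. -/
theorem mul_card_le_sum {A B : Finset F[X]} {n : ℕ} {a : F} (ha : a ≠ 0)
    (hA : ∀ f ∈ A, f.Monic ∧ f.natDegree = n ∧ f.coeff 0 = a)
    (hB : ∀ f ∈ A, ∀ p i f', Irreducible p → p.Monic → 1 ≤ i → p ^ i * f' = f → f' ∈ B) :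
    (n : ℝ) * A.card ≤ 2 * (Fintype.card F : ℝ) ^ (n - 1) *
      ∑ f ∈ B, ((Fintype.card F : ℝ)⁻¹) ^ f.natDegree := by
  have hq0 : (0 : ℝ) < Fintype.card F := by exact_mod_cast Fintype.card_pos
  have hex : ∀ f : F[X], ∃ E : Finset (Σ _ : F[X], ℕ), f.Monic →
      (∀ x ∈ E, Irreducible x.1 ∧ x.1.Monic ∧ 1 ≤ x.2 ∧ x.1 ^ x.2 ∣ f) ∧
        ∑ x ∈ E, x.1.natDegree = f.natDegree := fun f => by
    by_cases hf : f.Monic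
    · obtain ⟨E, hE⟩ := exists_primePow_divisors hf
      exact ⟨E, fun _ => hE⟩
    · exact ⟨∅, fun h => absurd h hf⟩
  choose E hE using hex
  let quo : (Σ _ : F[X], Σ _ : F[X], ℕ) → F[X] := fun y => y.1 / y.2.1 ^ y.2.2
  have hy : ∀ y ∈ A.sigma E, y.1 ∈ A ∧ Irreducible y.2.1 ∧ y.2.1.Monic ∧ 1 ≤ y.2.2 ∧
      y.2.1 ^ y.2.2 * quo y = y.1 := by
    rintro ⟨f, p, i⟩ h
    rw [mem_sigma] at h
    obtain ⟨h1, h2, h3, h4⟩ := (hE f (hA f h.1).1).1 _ h.2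
    exact ⟨h.1, h1, h2, h3, EuclideanDomain.mul_div_cancel' (pow_ne_zero _ h1.ne_zero) h4⟩
  have hdeg : ∀ y ∈ A.sigma E, y.2.1.natDegree * y.2.2 + (quo y).natDegree = n ∧
      y.2.1.coeff 0 ^ y.2.2 * (quo y).coeff 0 = a ∧ y.2.1.natDegree ≠ 0 := by
    intro y hyA
    obtain ⟨h1, h2, h3, h4, h5⟩ := hy y hyA
    obtain ⟨h6, h7, h8⟩ := hA _ h1
    have hmon : (quo y).Monic := (h3.pow _).of_mul_monic_left (by rwa [h5])
    refine ⟨?_, ?_, h2.natDegree_pos.ne'⟩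
    · rw [← h7, ← h5, (h3.pow _).natDegree_mul hmon, h3.natDegree_pow, mul_comm]
    · rw [← h8, ← h5]
      simp only [coeff_zero_eq_eval_zero, eval_mul, eval_pow]
  have hsum : n * A.card = ∑ y ∈ A.sigma E, y.2.1.natDegree := by
    rw [sum_sigma, mul_comm, ← smul_eq_mul, ← sum_const]
    exact sum_congr rfl fun f hf => by rw [(hE f (hA f hf).1).2, (hA f hf).2.1]
  have hfib : ∀ g ∈ B, ((∑ y ∈ A.sigma E with quo y = g, y.2.1.natDegree : ℕ) : ℝ) ≤
      2 * (Fintype.card F : ℝ) ^ (n - 1) * ((Fintype.card F : ℝ)⁻¹) ^ g.natDegree := by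
    intro g _
    rcases (A.sigma E).filter (fun y => quo y = g) |>.eq_empty_or_nonempty with h0 | ⟨y₀, hy₀⟩
    · rw [h0]
      simp only [sum_empty, Nat.cast_zero]
      positivity
    rw [mem_filter] at hy₀
    have hd₀ := hdeg _ hy₀.1
    have hi₀ := (hy _ hy₀.1).2.2.2.1
    rw [hy₀.2] at hd₀
    have hpos : 0 < y₀.2.1.natDegree * y₀.2.2 := Nat.mul_pos (Nat.pos_of_ne_zero hd₀.2.2) hi₀
    have hg0 : g.coeff 0 ≠ 0 := by
      rintro h
      rw [h, mul_zero] at hd₀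
      exact ha hd₀.2.1.symm
    have hinj : Set.InjOn (fun y : (Σ _ : F[X], Σ _ : F[X], ℕ) => y.2.1)
        ((A.sigma E).filter (fun y => quo y = g) : Finset _) := by
      intro y hyB z hzB (hyz : y.2.1 = z.2.1)
      simp only [coe_filter, Set.mem_ofPred_eq] at hyB hzB
      have h1 := (hdeg _ hyB.1).1
      have h2 := (hdeg _ hzB.1).1
      have h3 := (hy _ hyB.1).2.2.2.2
      have h4 := (hy _ hzB.1).2.2.2.2
      rw [hyB.2] at h1 h3
      rw [hzB.2, ← hyz] at h2 h4
      have h5 : y.2.2 = z.2.2 :=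
        Nat.eq_of_mul_eq_mul_left (Nat.pos_of_ne_zero (hdeg _ hyB.1).2.2) (by omega)
      rw [h5] at h3
      obtain ⟨f, p, i⟩ := y
      obtain ⟨f', p', i'⟩ := z
      simp only at hyz h5 h3 h4
      subst hyz h5
      rw [← h3, h4]
    have hb := sum_natDegree_le_of_pow_coeff_zero (d := n - g.natDegree)
      (D := ((A.sigma E).filter (fun y => quo y = g)).image fun y => y.2.1) (by omega)
      (a / g.coeff 0) (by
        simp only [mem_image, mem_filter]
        rintro p ⟨y, ⟨hyA, hyg⟩, rfl⟩
        have h1 := hdeg _ hyA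
        rw [hyg] at h1
        refine ⟨(hy y hyA).2.1, (hy y hyA).2.2.1, y.2.2, by omega, ?_⟩
        rw [eq_div_iff hg0, h1.2.1])
    rw [sum_image hinj] at hb
    have hn : n - 1 = (n - g.natDegree - 1) + g.natDegree := by omega
    rw [hn, pow_add, mul_assoc, mul_assoc, inv_pow, mul_inv_cancel₀ (by positivity), mul_one]
    exact_mod_cast hb
  rw [mul_sum]
  calc (n : ℝ) * A.card = ((∑ y ∈ A.sigma E, y.2.1.natDegree : ℕ) : ℝ) := by
        rw [← hsum]; push_cast; rfl
    _ = ∑ g ∈ B, ((∑ y ∈ A.sigma E with quo y = g, y.2.1.natDegree : ℕ) : ℝ) := by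
        rw [← Nat.cast_sum, sum_fiberwise_of_maps_to]
        intro y hyA
        obtain ⟨h1, h2, h3, h4, h5⟩ := hy y hyA
        exact hB _ h1 _ _ _ h2 h3 h4 h5
    _ ≤ _ := sum_le_sum hfib

/-- The number of distinct irreducible factors of `f` whose degree satisfies `P`. -/
noncomputable def primeCount (P : ℕ → Prop) (f : F[X]) : ℕ :=
  #{p ∈ primeFactors f | P p.natDegree}

omit [Fintype F] in
theorem primeCount_le_of_dvd (P : ℕ → Prop) {f g : F[X]} (hg : g ≠ 0) (h : f ∣ g) :
    primeCount P f ≤ primeCount P g := by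
  refine card_le_card (filter_subset_filter _ fun p hp => ?_)
  rw [mem_primeFactors_iff (ne_zero_of_dvd_ne_zero hg h)] at hp
  exact (mem_primeFactors_iff hg).2 ⟨hp.1, hp.2.1, hp.2.2.trans h⟩

omit [Fintype F] in
theorem primeFactors_pow_mul {p f : F[X]} (hp : Irreducible p) (hmon : p.Monic) {i : ℕ}
    (hi : i ≠ 0) (hf : f ≠ 0) : primeFactors (p ^ i * f) = insert p (primeFactors f) := by
  ext r
  rw [mem_insert, mem_primeFactors_iff (mul_ne_zero (pow_ne_zero _ hp.ne_zero) hf),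
    mem_primeFactors_iff hf]
  constructor
  · rintro ⟨h1, h2, h3⟩
    rcases h1.prime.dvd_or_dvd h3 with h | h
    · exact Or.inl (eq_of_monic_of_associated h2 hmon
        (h1.associated_of_dvd hp (h1.prime.dvd_of_dvd_pow h)))
    · exact Or.inr ⟨h1, h2, h⟩
  · rintro (rfl | ⟨h1, h2, h3⟩)
    · exact ⟨hp, hmon, (dvd_pow_self r hi).mul_right _⟩
    · exact ⟨h1, h2, h3.mul_left _⟩

omit [Fintype F] in
theorem primeCount_pow_mul_le (P : ℕ → Prop) {p f : F[X]} (hp : Irreducible p) (hmon : p.Monic)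
    {i : ℕ} (hi : i ≠ 0) (hf : f ≠ 0) : primeCount P (p ^ i * f) ≤ primeCount P f + 1 := by
  unfold primeCount
  rw [primeFactors_pow_mul hp hmon hi hf, filter_insert]
  split_ifs
  · exact card_insert_le _ _
  · exact Nat.le_succ _

omit [Fintype F] in
theorem primeCount_pow_mul_of_pos {P : ℕ → Prop} {p f : F[X]} (hp : Irreducible p)
    (hmon : p.Monic) {i : ℕ} (hi : i ≠ 0) (hf : f ≠ 0) (hdvd : ¬ p ∣ f) (hP : P p.natDegree) :
    primeCount P (p ^ i * f) = primeCount P f + 1 := by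
  unfold primeCount
  rw [primeFactors_pow_mul hp hmon hi hf, filter_insert, if_pos hP, card_insert_of_notMem]
  rw [mem_filter, mem_primeFactors_iff hf]
  tauto

omit [Fintype F] in
theorem primeCount_pow_mul_of_neg {P : ℕ → Prop} {p f : F[X]} (hp : Irreducible p)
    (hmon : p.Monic) {i : ℕ} (hi : i ≠ 0) (hf : f ≠ 0) (hP : ¬ P p.natDegree) :
    primeCount P (p ^ i * f) = primeCount P f := by
  unfold primeCount
  rw [primeFactors_pow_mul hp hmon hi hf, filter_insert, if_neg hP]

/-- Removing one prime power from each of the `j` admissible ones. -/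
theorem mul_sum_le_of_primeCount {W : F[X] → ℝ} (hW0 : ∀ f, 0 ≤ W f)
    (hsub : ∀ p i f, Irreducible p → p.Monic → f.Monic → ¬ p ∣ f →
      W (p ^ i * f) ≤ W (p ^ i) * W f)
    {U V : Finset F[X]} {P : ℕ → Prop} {n j : ℕ} {A : ℝ}
    (hU : ∀ f ∈ U, f ∈ monicsLT F n ∧ primeCount P f = j)
    (hV : ∀ f ∈ U, ∀ p i f', Irreducible p → p.Monic → P p.natDegree → i ≠ 0 → f'.Monic →
      ¬ p ∣ f' → p ^ i * f' = f → f' ∈ V)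
    (hA : ∑ p ∈ monicsLT F n with Irreducible p ∧ P p.natDegree, ∑ i ∈ Icc 1 n, W (p ^ i) ≤ A) :
    j * ∑ f ∈ U, W f ≤ A * ∑ f ∈ V, W f := by
  have hex : ∀ f p : F[X], ∃ x : ℕ × F[X], f ≠ 0 → Irreducible p →
      ¬ p ∣ x.2 ∧ f = p ^ x.1 * x.2 := fun f p => by
    by_cases h : f ≠ 0 ∧ Irreducible p
    · obtain ⟨i, g, hg⟩ := WfDvdMonoid.max_power_factor h.1 h.2
      exact ⟨(i, g), fun _ _ => hg⟩
    · exact ⟨(0, 0), fun h1 h2 => absurd ⟨h1, h2⟩ h⟩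
  choose e he using hex
  let S := U.sigma fun f => {p ∈ primeFactors f | P p.natDegree}
  have hS : ∀ y ∈ S, y.1 ∈ U ∧ Irreducible y.2 ∧ y.2.Monic ∧ P y.2.natDegree ∧
      y.2 ∣ y.1 ∧ ¬ y.2 ∣ (e y.1 y.2).2 ∧ y.2 ^ (e y.1 y.2).1 * (e y.1 y.2).2 = y.1 := by
    rintro ⟨f, p⟩ h
    have h1 := mem_sigma.1 h
    have hf := (mem_monicsLT.1 (hU f h1.1).1).1.ne_zero
    obtain ⟨h2, h3⟩ := mem_filter.1 h1.2
    obtain ⟨h4, h5, h6⟩ := (mem_primeFactors_iff hf).1 h2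
    exact ⟨h1.1, h4, h5, h3, h6, (he f p hf h4).1, (he f p hf h4).2.symm⟩
  have hS' : ∀ y ∈ S, (e y.1 y.2).1 ≠ 0 ∧ (e y.1 y.2).2.Monic := by
    intro y hy
    obtain ⟨h1, h2, h3, h4, h5, h6, h7⟩ := hS y hy
    have hm := (mem_monicsLT.1 (hU _ h1).1).1
    refine ⟨fun h0 => h6 ?_, (h3.pow _).of_mul_monic_left (by rwa [h7])⟩
    rw [h0, pow_zero, one_mul] at h7
    rwa [h7]
  have hle : ∑ y ∈ S, W y.1 ≤
      ∑ z ∈ (({p ∈ monicsLT F n | Irreducible p ∧ P p.natDegree} ×ˢ Icc 1 n) ×ˢ V),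
        W (z.1.1 ^ z.1.2) * W z.2 := by
    refine sum_le_sum_of_injOn (fun y => ((y.2, (e y.1 y.2).1), (e y.1 y.2).2)) ?_ ?_ ?_ ?_
    · intro y hy
      obtain ⟨h1, h2, h3, h4, h5, h6, h7⟩ := hS y hy
      obtain ⟨h8, h9⟩ := hS' y hy
      obtain ⟨h10, h11, h12⟩ := mem_monicsLT.1 (hU _ h1).1
      have hdeg : (e y.1 y.2).1 * y.2.natDegree + (e y.1 y.2).2.natDegree = y.1.natDegree := by
        conv_rhs => rw [← h7]
        rw [(h3.pow _).natDegree_mul h9, h3.natDegree_pow]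
      have hpos := h2.natDegree_pos
      have hi : (e y.1 y.2).1 ≤ (e y.1 y.2).1 * y.2.natDegree := Nat.le_mul_of_pos_right _ hpos
      have hc : y.2.coeff 0 ≠ 0 := by
        obtain ⟨g, hg⟩ := h5
        rw [hg, mul_coeff_zero] at h12
        exact left_ne_zero_of_mul h12
      have hp : y.2.natDegree ≤ y.1.natDegree := natDegree_le_of_dvd h5 h10.ne_zero
      rw [mem_product, mem_product, mem_filter, mem_Icc, mem_monicsLT]
      exact ⟨⟨⟨⟨h3, hp.trans_lt h11, hc⟩, h2, h4⟩, Nat.one_le_iff_ne_zero.2 h8, by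
        dsimp only; omega⟩, hV _ h1 _ _ _ h2 h3 h4 h8 h9 h6 h7⟩
    · rintro ⟨f, p⟩ hy ⟨f', p'⟩ hz h
      have h1 := (hS _ hy).2.2.2.2.2.2
      have h2 := (hS _ hz).2.2.2.2.2.2
      simp only [Prod.mk.injEq] at h h1 h2
      obtain ⟨⟨rfl, h4⟩, h5⟩ := h
      rw [← h4, ← h5, h1] at h2
      rw [h2]
    · intro y hy
      obtain ⟨h1, h2, h3, h4, h5, h6, h7⟩ := hS y hy
      conv_lhs => rw [← h7]
      exact hsub _ _ _ h2 h3 (hS' y hy).2 h6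
    · exact fun z _ => mul_nonneg (hW0 _) (hW0 _)
  calc j * ∑ f ∈ U, W f = ∑ y ∈ S, W y.1 := by
        rw [sum_sigma, mul_sum]
        refine sum_congr rfl fun f hf => ?_
        rw [← (hU f hf).2]
        exact ((sum_const _).trans (nsmul_eq_mul _ _)).symm
    _ ≤ _ := hle
    _ = (∑ p ∈ monicsLT F n with Irreducible p ∧ P p.natDegree, ∑ i ∈ Icc 1 n, W (p ^ i)) *
          ∑ f ∈ V, W f := by
        rw [sum_product, sum_product, sum_mul]
        refine sum_congr rfl fun p _ => ?_
        rw [sum_mul]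
        exact sum_congr rfl fun i _ => by rw [mul_sum]
    _ ≤ _ := mul_le_mul_of_nonneg_right hA (sum_nonneg fun f _ => hW0 f)

/-- A Hardy–Ramanujan type bound for submultiplicative weights. -/
theorem sum_primeCount_eq_le {W : F[X] → ℝ} (hW0 : ∀ f, 0 ≤ W f) (hW1 : W 1 ≤ 1)
    (hsub : ∀ p i f, Irreducible p → p.Monic → f.Monic → ¬ p ∣ f →
      W (p ^ i * f) ≤ W (p ^ i) * W f) {P Q : ℕ → Prop}
    (hPQ : ∀ d, Q d ↔ ¬ P d) {n : ℕ} {A B : ℝ}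
    (hA : ∑ p ∈ monicsLT F n with Irreducible p ∧ P p.natDegree,
      ∑ i ∈ Icc 1 n, W (p ^ i) ≤ A)
    (hB : ∑ p ∈ monicsLT F n with Irreducible p ∧ Q p.natDegree,
      ∑ i ∈ Icc 1 n, W (p ^ i) ≤ B) (j : ℕ) :
    ∑ f ∈ monicsLT F n with primeCount P f = j, W f ≤
      A ^ j / j.factorial * Real.exp B := by
  have hA0 : 0 ≤ A := (sum_nonneg fun p _ => sum_nonneg fun i _ => hW0 _).trans hA
  have hB0 : 0 ≤ B := (sum_nonneg fun p _ => sum_nonneg fun i _ => hW0 _).trans hB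
  let N : ℕ → ℕ → Finset F[X] := fun j l =>
    {f ∈ monicsLT F n | primeCount P f = j ∧ primeCount Q f = l}
  have hN : ∀ {j l f}, f ∈ N j l ↔
      f ∈ monicsLT F n ∧ primeCount P f = j ∧ primeCount Q f = l := by
    intro j l f
    exact mem_filter
  have hquo : ∀ {f f' p : F[X]} {i : ℕ}, f ∈ monicsLT F n → f'.Monic → p ^ i * f' = f →
      f' ∈ monicsLT F n := by
    intro f f' p i hf hf' h
    obtain ⟨h1, h2, h3⟩ := mem_monicsLT.1 hf
    have hd : f' ∣ f := ⟨p ^ i, by rw [← h, mul_comm]⟩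
    refine mem_monicsLT.2 ⟨hf', (natDegree_le_of_dvd hd h1.ne_zero).trans_lt h2, fun h0 => h3 ?_⟩
    rw [← h, mul_coeff_zero, h0, mul_zero]
  have h00 : ∑ f ∈ N 0 0, W f ≤ 1 := by
    have : N 0 0 ⊆ {1} := by
      intro f hf
      obtain ⟨h1, h2, h3⟩ := hN.1 hf
      have hm := (mem_monicsLT.1 h1).1
      have hempty : primeFactors f = ∅ := by
        rw [primeCount, card_eq_zero] at h2 h3
        refine eq_empty_of_forall_notMem fun p hp => ?_
        by_cases hP : P p.natDegree
        · exact notMem_empty p (h2 ▸ mem_filter.2 ⟨hp, hP⟩)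
        · exact notMem_empty p (h3 ▸ mem_filter.2 ⟨hp, (hPQ _).2 hP⟩)
      rw [primeFactors_eq_empty_iff hm.ne_zero] at hempty
      exact mem_singleton.2 (hm.eq_one_of_isUnit hempty)
    calc ∑ f ∈ N 0 0, W f ≤ ∑ f ∈ {1}, W f :=
          sum_le_sum_of_subset_of_nonneg this fun f _ _ => hW0 f
      _ ≤ 1 := by simpa using hW1
  have hl : ∀ l, ∑ f ∈ N 0 l, W f ≤ B ^ l / l.factorial := by
    intro l
    induction l with
    | zero => simpa using h00
    | succ l ih =>
      have := mul_sum_le_of_primeCount hW0 hsub (U := N 0 (l + 1)) (V := N 0 l) (P := Q)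
        (fun f hf => ⟨(hN.1 hf).1, (hN.1 hf).2.2⟩) (by
          rintro f hf p i f' hp hm hP hi hf' hd rfl
          obtain ⟨h1, h2, h3⟩ := hN.1 hf
          rw [primeCount_pow_mul_of_neg hp hm hi hf'.ne_zero ((hPQ _).1 hP)] at h2
          rw [primeCount_pow_mul_of_pos hp hm hi hf'.ne_zero hd hP] at h3
          exact hN.2 ⟨hquo h1 hf' rfl, h2, Nat.succ_injective h3⟩) hB
      have h2 := this.trans (mul_le_mul_of_nonneg_left ih hB0)
      rw [Nat.factorial_succ, le_div_iff₀ (by positivity)]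
      push_cast at h2 ⊢
      calc _ = ((l + 1) * ∑ f ∈ N 0 (l + 1), W f) * l.factorial := by ring
        _ ≤ (B * (B ^ l / l.factorial)) * l.factorial := by gcongr
        _ = _ := by field_simp; ring
  have hj : ∀ j l, ∑ f ∈ N j l, W f ≤ A ^ j / j.factorial * (B ^ l / l.factorial) := by
    intro j l
    induction j with
    | zero => simpa using hl l
    | succ j ih =>
      have := mul_sum_le_of_primeCount hW0 hsub (U := N (j + 1) l) (V := N j l) (P := P)
        (fun f hf => ⟨(hN.1 hf).1, (hN.1 hf).2.1⟩) (by
          rintro f hf p i f' hp hm hP hi hf' hd rfl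
          obtain ⟨h1, h2, h3⟩ := hN.1 hf
          rw [primeCount_pow_mul_of_pos hp hm hi hf'.ne_zero hd hP] at h2
          rw [primeCount_pow_mul_of_neg hp hm hi hf'.ne_zero fun h => (hPQ _).1 h hP] at h3
          exact hN.2 ⟨hquo h1 hf' rfl, Nat.succ_injective h2, h3⟩) hA
      have h2 := this.trans (mul_le_mul_of_nonneg_left ih hA0)
      rw [Nat.factorial_succ, div_mul_eq_mul_div, le_div_iff₀ (by positivity)]
      push_cast at h2 ⊢
      calc _ = ((j + 1) * ∑ f ∈ N (j + 1) l, W f) * j.factorial := by ring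
        _ ≤ (A * (A ^ j / j.factorial * (B ^ l / l.factorial))) * j.factorial := by gcongr
        _ = _ := by field_simp; ring
  obtain ⟨m, hm⟩ := ((monicsLT F n).image (primeCount Q)).exists_nat_subset_range
  calc ∑ f ∈ monicsLT F n with primeCount P f = j, W f
      = ∑ l ∈ range m, ∑ f ∈ N j l, W f := by
        rw [← sum_fiberwise_of_maps_to (t := range m) (g := primeCount Q)
          fun f hf => hm (mem_image_of_mem _ (mem_filter.1 hf).1)]
        exact sum_congr rfl fun l _ => by rw [filter_filter]
    _ ≤ ∑ l ∈ range m, A ^ j / j.factorial * (B ^ l / l.factorial) :=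
        sum_le_sum fun l _ => hj j l
    _ = A ^ j / j.factorial * ∑ l ∈ range m, B ^ l / l.factorial := by rw [mul_sum]
    _ ≤ _ := by
        gcongr
        exact Real.sum_le_exp_of_nonneg hB0 m

/-- Sums over irreducible polynomials of a function of the degree. -/
theorem sum_irreducible_le {D : Finset F[X]} {S : Finset ℕ} {φ : ℕ → ℝ} (hφ : ∀ d, 0 ≤ φ d)
    (hS : ∀ d ∈ S, 1 ≤ d)
    (hD : ∀ p ∈ D, Irreducible p ∧ p.Monic ∧ p.coeff 0 ≠ 0 ∧ p.natDegree ∈ S) :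
    ∑ p ∈ D, φ p.natDegree ≤ ∑ d ∈ S, ((Fintype.card F : ℝ) ^ d - 1) / d * φ d := by
  rw [← sum_fiberwise_of_maps_to (t := S) (g := natDegree) fun p hp => (hD p hp).2.2.2]
  refine sum_le_sum fun d hd => ?_
  have hd1 : (0 : ℝ) < d := by exact_mod_cast hS d hd
  rw [sum_congr rfl fun p hp => by rw [(mem_filter.1 hp).2], sum_const, nsmul_eq_mul]
  refine mul_le_mul_of_nonneg_right ?_ (hφ d)
  rw [le_div_iff₀ hd1]
  have h := card_mul_le_of_irreducible (D := {p ∈ D | p.natDegree = d}) (d := d) fun p hp => by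
    obtain ⟨h1, h2⟩ := mem_filter.1 hp
    obtain ⟨h3, h4, h5, -⟩ := hD p h1
    exact ⟨h3, h4, h5, h2⟩
  have h1 : 1 ≤ Fintype.card F ^ d := Nat.one_le_pow _ _ Fintype.card_pos
  have h2 : ((#{p ∈ D | p.natDegree = d} * d : ℕ) : ℝ) ≤ ((Fintype.card F ^ d - 1 : ℕ) : ℝ) := by
    exact_mod_cast h
  rw [Nat.cast_sub h1] at h2
  exact_mod_cast h2

theorem sum_Icc_inv_pow_le {Q : ℝ} (hQ : 1 < Q) (n : ℕ) :
    ∑ i ∈ Icc 1 n, Q⁻¹ ^ i ≤ 1 / (Q - 1) := by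
  have hQ0 : 0 < Q := by linarith
  have h : ∑ i ∈ Icc 1 n, Q⁻¹ ^ i = (1 - Q⁻¹ ^ n) / (Q - 1) := by
    have : Q - 1 ≠ 0 := by linarith
    induction n with
    | zero => simp
    | succ n ih =>
      rw [sum_Icc_succ_top (by omega), ih, pow_succ]
      field_simp
      ring
  rw [h]
  have : 0 ≤ Q⁻¹ ^ n := by positivity
  exact div_le_div_of_nonneg_right (by linarith) (by linarith)

theorem sum_Icc_add_one_mul_inv_pow_le {Q : ℝ} (hQ : 1 < Q) (n : ℕ) :
    ∑ i ∈ Icc 1 n, ((i : ℝ) + 1) * Q⁻¹ ^ i ≤ (2 + 1 / (Q - 1)) / (Q - 1) := by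
  have hQ0 : 0 < Q := by linarith
  have hQ1 : Q - 1 ≠ 0 := by linarith
  have hlt : ‖Q⁻¹‖ < 1 := by
    rw [Real.norm_of_nonneg (by positivity)]
    exact inv_lt_one_of_one_lt₀ hQ
  have h1 := sum_le_hasSum (Icc 1 n) (fun i _ => by positivity)
    (hasSum_coe_mul_geometric_of_norm_lt_one hlt)
  have h2 := sum_Icc_inv_pow_le hQ n
  simp_rw [add_mul, one_mul]
  rw [sum_add_distrib]
  refine (add_le_add h1 h2).trans (le_of_eq ?_)
  have h3 : 1 - Q⁻¹ = (Q - 1) / Q := by field_simp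
  rw [h3]
  field_simp
  ring

theorem sum_Icc_inv_le_one_add_log (k : ℕ) :
    ∑ d ∈ Icc 1 k, (d : ℝ)⁻¹ ≤ 1 + Real.log k := by
  have := harmonic_le_one_add_log k
  simp_rw [harmonic_eq_sum_Icc, Rat.cast_sum, Rat.cast_inv, Rat.cast_natCast] at this
  exact this

theorem sum_Ioc_inv_le_log {k m : ℕ} (hk : 1 ≤ k) (hm : k ≤ m) :
    ∑ d ∈ Ioc k m, (d : ℝ)⁻¹ ≤ Real.log (m / k) := by
  have hk0 : (0 : ℝ) < k := by exact_mod_cast hk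
  induction m, hm using Nat.le_induction with
  | base => simp [hk0.ne']
  | succ m hm ih =>
    have hm0 : (0 : ℝ) < m := hk0.trans_le (by exact_mod_cast hm)
    rw [sum_Ioc_succ_top hm]
    have h1 := Real.one_sub_inv_le_log_of_pos (show (0 : ℝ) < (m + 1) / m by positivity)
    rw [Real.log_div hm0.ne' hk0.ne'] at ih
    rw [Real.log_div (by positivity) hm0.ne'] at h1
    push_cast
    rw [Real.log_div (by positivity) hk0.ne']
    have h2 : 1 - ((m + 1 : ℝ) / m)⁻¹ = (m + 1 : ℝ)⁻¹ := by field_simp; ring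
    linarith

theorem one_lt_card_cast (F : Type*) [Field F] [Fintype F] : (1 : ℝ) < Fintype.card F := by
  exact_mod_cast Fintype.one_lt_card

/-- The Euler factors at irreducible polynomials of degree more than `k`. -/
theorem sum_large_irreducible_le {W : F[X] → ℝ} {n k : ℕ} (hk : 1 ≤ k) (hkn : k < n)
    (hW : ∀ p i, Irreducible p → p.Monic → k < p.natDegree →
      W (p ^ i) ≤ ((Fintype.card F : ℝ)⁻¹) ^ (p.natDegree * i)) {D : Finset F[X]}
    (hD : ∀ p ∈ D, p ∈ monicsLT F n ∧ Irreducible p ∧ k < p.natDegree) :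
    ∑ p ∈ D, ∑ i ∈ Icc 1 n, W (p ^ i) ≤ Real.log (n / k) := by
  have hq := one_lt_card_cast F
  have hk0 : (0 : ℝ) < k := by exact_mod_cast hk
  have hpow : ∀ d : ℕ, (1 : ℝ) ≤ (Fintype.card F : ℝ) ^ d := fun d => one_le_pow₀ hq.le
  calc ∑ p ∈ D, ∑ i ∈ Icc 1 n, W (p ^ i)
      ≤ ∑ p ∈ D, 1 / ((Fintype.card F : ℝ) ^ p.natDegree - 1) := by
        refine sum_le_sum fun p hp => ?_
        obtain ⟨h1, h2, h3⟩ := hD p hp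
        refine le_trans (sum_le_sum fun i _ => ?_)
          (sum_Icc_inv_pow_le (one_lt_pow₀ hq h2.natDegree_pos.ne') n)
        rw [← inv_pow, ← pow_mul]
        exact hW p i h2 (mem_monicsLT.1 h1).1 h3
    _ ≤ ∑ d ∈ Ioc k (n - 1), ((Fintype.card F : ℝ) ^ d - 1) / d *
          (1 / ((Fintype.card F : ℝ) ^ d - 1)) := by
        refine sum_irreducible_le (φ := fun d => 1 / ((Fintype.card F : ℝ) ^ d - 1))
          (fun d => one_div_nonneg.2 (sub_nonneg.2 (hpow d)))
          (fun d hd => by rw [mem_Ioc] at hd; omega) fun p hp => ?_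
        obtain ⟨h1, h2, h3⟩ := hD p hp
        obtain ⟨h4, h5, h6⟩ := mem_monicsLT.1 h1
        exact ⟨h2, h4, h6, mem_Ioc.2 ⟨h3, by omega⟩⟩
    _ = ∑ d ∈ Ioc k (n - 1), (d : ℝ)⁻¹ := by
        refine sum_congr rfl fun d hd => ?_
        have hd0 : d ≠ 0 := by rw [mem_Ioc] at hd; omega
        have : (Fintype.card F : ℝ) ^ d - 1 ≠ 0 := by
          have := one_lt_pow₀ hq hd0
          linarith
        field_simp
    _ ≤ Real.log ((n - 1 : ℕ) / k) := sum_Ioc_inv_le_log hk (by omega)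
    _ ≤ Real.log (n / k) := by
        have : (0 : ℝ) < (n - 1 : ℕ) := by exact_mod_cast (by omega : 0 < n - 1)
        have h2 : ((n - 1 : ℕ) : ℝ) ≤ n := by exact_mod_cast Nat.sub_le n 1
        gcongr

/-- The Euler factors at irreducible polynomials of degree at most `k`. -/
theorem sum_small_irreducible_le {W : F[X] → ℝ} {n k : ℕ} {φ : ℕ → ℝ} (hφ : ∀ d, 0 ≤ φ d)
    (hW : ∀ p, Irreducible p → p.Monic →
      ∑ i ∈ Icc 1 n, W (p ^ i) ≤ φ p.natDegree / ((Fintype.card F : ℝ) ^ p.natDegree - 1))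
    {D : Finset F[X]} (hD : ∀ p ∈ D, p ∈ monicsLT F n ∧ Irreducible p ∧ p.natDegree ≤ k) :
    ∑ p ∈ D, ∑ i ∈ Icc 1 n, W (p ^ i) ≤ ∑ d ∈ Icc 1 k, φ d * (d : ℝ)⁻¹ := by
  have hq := one_lt_card_cast F
  calc ∑ p ∈ D, ∑ i ∈ Icc 1 n, W (p ^ i)
      ≤ ∑ p ∈ D, φ p.natDegree / ((Fintype.card F : ℝ) ^ p.natDegree - 1) :=
        sum_le_sum fun p hp => hW p (hD p hp).2.1 (mem_monicsLT.1 (hD p hp).1).1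
    _ ≤ ∑ d ∈ Icc 1 k, ((Fintype.card F : ℝ) ^ d - 1) / d *
          (φ d / ((Fintype.card F : ℝ) ^ d - 1)) := by
        refine sum_irreducible_le (φ := fun d => φ d / ((Fintype.card F : ℝ) ^ d - 1))
          (fun d => div_nonneg (hφ d) (sub_nonneg.2 (one_le_pow₀ hq.le)))
          (fun d hd => (mem_Icc.1 hd).1) fun p hp => ?_
        obtain ⟨h1, h2, h3⟩ := hD p hp
        obtain ⟨h4, h5, h6⟩ := mem_monicsLT.1 h1
        exact ⟨h2, h4, h6, mem_Icc.2 ⟨h2.natDegree_pos, h3⟩⟩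
    _ = ∑ d ∈ Icc 1 k, φ d * (d : ℝ)⁻¹ := by
        refine sum_congr rfl fun d hd => ?_
        have hd0 : d ≠ 0 := by rw [mem_Icc] at hd; omega
        have : (Fintype.card F : ℝ) ^ d - 1 ≠ 0 := by
          have := one_lt_pow₀ hq hd0
          linarith
        field_simp

theorem sum_primeCount_eq_inv_card_pow_le {n k : ℕ} (hk : 1 ≤ k) (hkn : k < n) (j : ℕ) :
    ∑ f ∈ monicsLT F n with primeCount (· ≤ k) f = j, ((Fintype.card F : ℝ)⁻¹) ^ f.natDegree ≤
      (1 + Real.log k) ^ j / j.factorial * (n / k) := by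
  have hq := one_lt_card_cast F
  have hk0 : (0 : ℝ) < k := by exact_mod_cast hk
  have hn0 : (0 : ℝ) < n := by exact_mod_cast (by omega : 0 < n)
  rw [← Real.exp_log (show (0 : ℝ) < n / k by positivity)]
  refine sum_primeCount_eq_le (W := fun f => ((Fintype.card F : ℝ)⁻¹) ^ f.natDegree)
    (fun f => by positivity) (by simp) (fun p i f _ hp hf _ => ?_) (Q := (k < ·))
    (fun d => not_le.symm) ?_ ?_ j
  · rw [(hp.pow i).natDegree_mul hf, pow_add]
  · refine (sum_small_irreducible_le (F := F)
      (W := fun f : F[X] => ((Fintype.card F : ℝ)⁻¹) ^ f.natDegree)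
      (k := k) (φ := fun _ => 1) (fun _ => zero_le_one)
      (fun p h1 h2 => ?_) fun p hp => by
      simpa only [mem_filter] using hp).trans ?_
    · refine le_trans (le_of_eq (sum_congr rfl fun i _ => ?_))
        (sum_Icc_inv_pow_le (one_lt_pow₀ hq h1.natDegree_pos.ne') n)
      rw [← inv_pow, ← pow_mul, h2.natDegree_pow, mul_comm]
    · simp_rw [one_mul]
      exact sum_Icc_inv_le_one_add_log k
  · refine sum_large_irreducible_le (F := F)
      (W := fun f : F[X] => ((Fintype.card F : ℝ)⁻¹) ^ f.natDegree)
      hk hkn (fun p i _ h2 _ => ?_) fun p hp => by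
      simpa only [mem_filter] using hp
    rw [h2.natDegree_pow, mul_comm]

/-- The number of monic divisors of `f` of degree less than `k` that are not divisible by `X`. -/
noncomputable def divisorCount (k : ℕ) (f : F[X]) : ℕ :=
  #{g ∈ monicsLT F k | g ∣ f}

theorem divisorCount_pow_mul_le (k : ℕ) {p f : F[X]} (i : ℕ) (hp : Irreducible p)
    (hmon : p.Monic) (hpf : ¬ p ∣ f) :
    divisorCount k (p ^ i * f) ≤ divisorCount k (p ^ i) * divisorCount k f := by
  unfold divisorCount
  rw [← card_product]
  refine (card_le_card (t := (({g ∈ monicsLT F k | g ∣ p ^ i} : Finset F[X]) ×ˢ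
    ({g ∈ monicsLT F k | g ∣ f} : Finset F[X])).image fun x => x.1 * x.2) fun g hg => ?_).trans
    card_image_le
  obtain ⟨h1, h2⟩ := mem_filter.1 hg
  obtain ⟨h3, h4, h5⟩ := mem_monicsLT.1 h1
  obtain ⟨s, g', h6, rfl⟩ := WfDvdMonoid.max_power_factor h3.ne_zero hp
  have hg' : g'.Monic := (hmon.pow s).of_mul_monic_left h3
  rw [(hmon.pow s).natDegree_mul hg'] at h4
  rw [mul_coeff_zero] at h5
  have hcop : IsCoprime p f := hp.coprime_iff_not_dvd.2 hpf
  have hcop' : IsCoprime p g' := hp.coprime_iff_not_dvd.2 h6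
  have hs : (p ^ s).natDegree < k := by omega
  have hg'k : g'.natDegree < k := by omega
  refine mem_image.2 ⟨(p ^ s, g'), mem_product.2 ⟨mem_filter.2 ⟨mem_monicsLT.2
    ⟨hmon.pow s, by omega, left_ne_zero_of_mul h5⟩, ?_⟩, mem_filter.2 ⟨mem_monicsLT.2
    ⟨hg', by omega, right_ne_zero_of_mul h5⟩, ?_⟩⟩, rfl⟩
  · exact hcop.pow_left.dvd_of_dvd_mul_right ((dvd_mul_right _ _).trans h2)
  · exact (hcop'.symm.pow_right).dvd_of_dvd_mul_left ((dvd_mul_left _ _).trans h2)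

theorem divisorCount_prime_pow_le (k i : ℕ) {p : F[X]} (hp : Irreducible p) (hmon : p.Monic) :
    divisorCount k (p ^ i) ≤ i + 1 ∧ (k ≤ p.natDegree → divisorCount k (p ^ i) ≤ 1) := by
  have hsub : ∀ g ∈ ({g ∈ monicsLT F k | g ∣ p ^ i} : Finset F[X]),
      g.natDegree < k ∧ ∃ s ≤ i, g = p ^ s := by
    intro g hg
    obtain ⟨h1, h2⟩ := mem_filter.1 hg
    obtain ⟨h3, h4, h5⟩ := mem_monicsLT.1 h1
    obtain ⟨s, hs, h⟩ := (dvd_prime_pow hp.prime i).1 h2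
    exact ⟨h4, s, hs, eq_of_monic_of_associated h3 (hmon.pow s) h⟩
  constructor
  · calc divisorCount k (p ^ i) ≤ #((range (i + 1)).image fun s => p ^ s) := by
          refine card_le_card fun g hg => ?_
          obtain ⟨-, s, hs, rfl⟩ := hsub g hg
          exact mem_image_of_mem _ (mem_range.2 (by omega))
      _ ≤ i + 1 := card_image_le.trans (card_range _).le
  · intro hk
    refine (card_le_card (t := {1}) fun g hg => ?_).trans (card_singleton _).le
    obtain ⟨h1, s, hs, rfl⟩ := hsub g hg
    rw [hmon.natDegree_pow] at h1
    have : s = 0 := by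
      by_contra h0
      have := Nat.le_mul_of_pos_left p.natDegree (Nat.pos_of_ne_zero h0)
      omega
    simp [this]

theorem sum_primeCount_eq_divisorCount_le {n k : ℕ} (hk : 1 ≤ k) (hkn : k < n) (j : ℕ) :
    ∑ f ∈ monicsLT F n with primeCount (· ≤ k) f = j,
        divisorCount k f * ((Fintype.card F : ℝ)⁻¹) ^ f.natDegree ≤
      (2 * (1 + Real.log k) + 2) ^ j / j.factorial * (n / k) := by
  have hq := one_lt_card_cast F
  have hq2 : (2 : ℝ) ≤ Fintype.card F := by exact_mod_cast Fintype.one_lt_card (α := F)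
  have hk0 : (0 : ℝ) < k := by exact_mod_cast hk
  have hn0 : (0 : ℝ) < n := by exact_mod_cast (by omega : 0 < n)
  rw [← Real.exp_log (show (0 : ℝ) < n / k by positivity)]
  refine sum_primeCount_eq_le
    (W := fun f => divisorCount k f * ((Fintype.card F : ℝ)⁻¹) ^ f.natDegree)
    (fun f => by positivity) ?_ (fun p i f h1 hp hf h2 => ?_) (Q := (k < ·))
    (fun d => not_le.symm) ?_ ?_ j
  · have : divisorCount k (1 : F[X]) ≤ 1 := by
      refine (card_le_card (t := {1}) fun g hg => ?_).trans (card_singleton _).le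
      obtain ⟨h1, h2⟩ := mem_filter.1 hg
      exact mem_singleton.2 ((mem_monicsLT.1 h1).1.eq_one_of_isUnit (isUnit_of_dvd_one h2))
    simpa using this
  · have h3 : (divisorCount k (p ^ i * f) : ℝ) ≤ divisorCount k (p ^ i) * divisorCount k f := by
      exact_mod_cast divisorCount_pow_mul_le k i h1 hp h2
    simp only [(hp.pow i).natDegree_mul hf, pow_add]
    calc _ ≤ ((divisorCount k (p ^ i) : ℝ) * divisorCount k f) * _ :=
          mul_le_mul_of_nonneg_right h3 (by positivity)
      _ = _ := by ring
  · refine (sum_small_irreducible_le (F := F) (W := fun f : F[X] =>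
      divisorCount k f * ((Fintype.card F : ℝ)⁻¹) ^ f.natDegree)
      (k := k) (φ := fun d => 2 + 2 * (2 : ℝ)⁻¹ ^ d)
      (fun _ => by positivity) (fun p h1 h2 => ?_) fun p hp => by
      simpa only [mem_filter] using hp).trans ?_
    · have hd := h1.natDegree_pos
      have h3 := one_lt_pow₀ hq hd.ne'
      refine le_trans (sum_le_sum fun i _ => ?_)
        ((sum_Icc_add_one_mul_inv_pow_le h3 n).trans ?_)
      · rw [← inv_pow, ← pow_mul, h2.natDegree_pow, mul_comm i]
        refine mul_le_mul_of_nonneg_right ?_ (by positivity)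
        exact_mod_cast (divisorCount_prime_pow_le k i h1 h2).1
      · refine div_le_div_of_nonneg_right (add_le_add le_rfl ?_) (by linarith)
        have h4 : (2 : ℝ) ^ p.natDegree ≤ (Fintype.card F : ℝ) ^ p.natDegree := by gcongr
        have h5 : (2 : ℝ) ≤ 2 ^ p.natDegree := by
          simpa using pow_le_pow_right₀ (one_le_two (α := ℝ)) hd
        rw [inv_pow, ← div_eq_mul_inv, div_le_div_iff₀ (by linarith) (by positivity)]
        linarith
    · simp_rw [add_mul]
      rw [sum_add_distrib, ← mul_sum]
      refine add_le_add (mul_le_mul_of_nonneg_left (sum_Icc_inv_le_one_add_log k) zero_le_two) ?_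
      calc ∑ d ∈ Icc 1 k, 2 * (2 : ℝ)⁻¹ ^ d * (d : ℝ)⁻¹ ≤ ∑ d ∈ Icc 1 k, 2 * (2 : ℝ)⁻¹ ^ d := by
            refine sum_le_sum fun d hd => mul_le_of_le_one_right (by positivity) ?_
            exact inv_le_one_of_one_le₀ (by exact_mod_cast (mem_Icc.1 hd).1)
        _ ≤ 2 := by
            rw [← mul_sum]
            have := sum_Icc_inv_pow_le (one_lt_two (α := ℝ)) k
            norm_num at this ⊢
            linarith
  · refine sum_large_irreducible_le (F := F) (W := fun f : F[X] =>
      divisorCount k f * ((Fintype.card F : ℝ)⁻¹) ^ f.natDegree)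
      hk hkn (fun p i h1 h2 h3 => ?_) fun p hp => by
      simpa only [mem_filter] using hp
    simp only [h2.natDegree_pow, mul_comm i]
    refine mul_le_of_le_one_left (by positivity) ?_
    exact_mod_cast (divisorCount_prime_pow_le k i h1 h2).2 h3.le

theorem mem_monicsLT_of_pow_mul {n i : ℕ} {p f f' : F[X]} (hf : f.Monic) (hn : f.natDegree = n)
    (h0 : f.coeff 0 ≠ 0) (hp : Irreducible p) (hmon : p.Monic) (hi : 1 ≤ i)
    (h : p ^ i * f' = f) : f' ∈ monicsLT F n := by
  subst h
  have h1 : f'.Monic := (hmon.pow i).of_mul_monic_left hf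
  rw [(hmon.pow i).natDegree_mul h1, hmon.natDegree_pow] at hn
  rw [mul_coeff_zero] at h0
  have := Nat.mul_pos hi hp.natDegree_pos
  exact mem_monicsLT.2 ⟨h1, by omega, right_ne_zero_of_mul h0⟩

theorem sum_le_sum_primeCount_fiberwise {P : ℕ → Prop} {W : F[X] → ℝ} (hW : ∀ f, 0 ≤ W f) {n : ℕ}
    {B : Finset F[X]} {S : Finset ℕ} (hB : ∀ f ∈ B, f ∈ monicsLT F n ∧ primeCount P f ∈ S) :
    ∑ f ∈ B, W f ≤ ∑ j ∈ S, ∑ f ∈ monicsLT F n with primeCount P f = j, W f := by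
  rw [← sum_fiberwise_of_maps_to (t := S) (g := primeCount P) fun f hf => (hB f hf).2]
  refine sum_le_sum fun j _ => sum_le_sum_of_subset_of_nonneg ?_ fun f _ _ => hW f
  exact filter_subset_filter _ fun f hf => (hB f hf).1

/-- Polynomials with many irreducible factors of degree at most `k` are rare. -/
theorem card_le_of_ceil_lt_primeCount {A : Finset F[X]} {n k : ℕ} {a : F} (ha : a ≠ 0)
    (hk : 1 ≤ k) (hkn : k < n) (hA : ∀ f ∈ A, f.Monic ∧ f.natDegree = n ∧ f.coeff 0 = a)
    (hω : ∀ f ∈ A, ⌈(1 + Real.log k) / Real.log 2⌉₊ < primeCount (· ≤ k) f) :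
    (#A : ℝ) ≤ 8 * Real.exp (1 - fordDelta) * ((Fintype.card F : ℝ) ^ (n - 1) *
      ((k : ℝ) ^ (-fordDelta) * (1 + Real.log k) ^ (-(1 / 2) : ℝ))) := by
  have hk1 : (1 : ℝ) ≤ k := by exact_mod_cast hk
  have hk0 : (0 : ℝ) < k := by linarith
  have hn0 : (0 : ℝ) < n := by exact_mod_cast (by omega : 0 < n)
  have hq0 : (0 : ℝ) < Fintype.card F := zero_lt_one.trans (one_lt_card_cast F)
  generalize hJ : ⌈(1 + Real.log k) / Real.log 2⌉₊ = J at hω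
  have h1 := mul_card_le_sum (B := {f ∈ monicsLT F n | J ≤ primeCount (· ≤ k) f}) ha hA
    fun f hf p i f' hp hmon hi h => by
      obtain ⟨h2, h3, h4⟩ := hA f hf
      have h5 := mem_monicsLT_of_pow_mul h2 h3 (h4 ▸ ha) hp hmon hi h
      have h6 := hω f hf
      have h7 := primeCount_pow_mul_le (· ≤ k) hp hmon (i := i) (by omega)
        (mem_monicsLT.1 h5).1.ne_zero
      rw [h] at h7
      exact mem_filter.2 ⟨h5, by omega⟩
  obtain ⟨m, hm⟩ := ((monicsLT F n).image (primeCount (· ≤ k))).exists_nat_subset_range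
  have h2 : ∑ f ∈ monicsLT F n with J ≤ primeCount (· ≤ k) f,
      ((Fintype.card F : ℝ)⁻¹) ^ f.natDegree ≤
        ∑ j ∈ Ico J m, (1 + Real.log k) ^ j / j.factorial * (n / k) := by
    refine (sum_le_sum_primeCount_fiberwise (P := (· ≤ k)) (S := Ico J m)
      (fun f => by positivity) fun f hf => ?_).trans
      (sum_le_sum fun j _ => sum_primeCount_eq_inv_card_pow_le hk hkn j)
    obtain ⟨h3, h4⟩ := mem_filter.1 hf
    exact ⟨h3, mem_Ico.2 ⟨h4, mem_range.1 (hm (mem_image_of_mem _ h3))⟩⟩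
  have h3 := sum_Ico_ceil_le hk1 m
  rw [hJ] at h3
  rw [← sum_mul] at h2
  refine le_of_mul_le_mul_left ?_ hn0
  calc (n : ℝ) * #A ≤ _ := h1
    _ ≤ 2 * (Fintype.card F : ℝ) ^ (n - 1) * ((4 * Real.exp (1 - fordDelta) *
          (k * (k : ℝ) ^ (-fordDelta) * (1 + Real.log k) ^ (-(1 / 2) : ℝ))) * (n / k)) := by
        refine mul_le_mul_of_nonneg_left (h2.trans ?_) (by positivity)
        exact mul_le_mul_of_nonneg_right h3 (by positivity)
    _ = _ := by
        field_simp
        ring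

/-- Replacing both cofactors of a factorization by polynomials of smaller degree. -/
theorem mul_mul_card_le_sum {A : Finset F[X]} {n k J : ℕ} {P : ℕ → Prop} {a : F} (ha : a ≠ 0)
    (hk : 1 ≤ k) (hkn : k < n) (hA : ∀ f ∈ A, f.Monic ∧ f.natDegree = n ∧ f.coeff 0 = a)
    (hdvd : ∀ f ∈ A, ∃ g : F[X], g.Monic ∧ g.natDegree = k ∧ g ∣ f)
    (hω : ∀ f ∈ A, primeCount P f ≤ J) :
    (k : ℝ) * (n - k : ℕ) * #A ≤ 4 * (Fintype.card F : ℝ) ^ (n - 1) *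
      ∑ f ∈ monicsLT F n with primeCount P f ≤ J,
        divisorCount k f * ((Fintype.card F : ℝ)⁻¹) ^ f.natDegree := by
  have hq0 : (0 : ℝ) < Fintype.card F := zero_lt_one.trans (one_lt_card_cast F)
  obtain ⟨m, rfl⟩ := Nat.exists_eq_add_of_lt hkn
  have hfac : ∀ f : F[X], ∃ x : F[X] × F[X], f ∈ A → x.1.Monic ∧ x.1.natDegree = k ∧
      x.1 * x.2 = f := fun f => by
    by_cases hf : f ∈ A
    · obtain ⟨g, hg, hgk, h, rfl⟩ := hdvd f hf
      exact ⟨(g, h), fun _ => ⟨hg, hgk, rfl⟩⟩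
    · exact ⟨(0, 0), fun h => absurd h hf⟩
  choose e he using hfac
  rw [show k + m + 1 - k = m + 1 by omega, show k + m + 1 - 1 = k + m by omega]
  let H : Finset F[X] := {h ∈ monicsLT F (m + 2) | h.natDegree = m + 1}
  let G : F[X] → Finset F[X] := fun h => {g ∈ monicsLT F (k + 1) | g.natDegree = k ∧
    g.coeff 0 * h.coeff 0 = a ∧ primeCount P (g * h) ≤ J}
  have hAG : #A ≤ ∑ h ∈ H, #(G h) := by
    rw [← card_sigma]
    refine card_le_card_of_injOn (fun f => ⟨(e f).2, (e f).1⟩) (fun f hf => ?_) ?_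
    · rw [mem_coe] at hf
      obtain ⟨h1, h2, h3⟩ := hA f hf
      obtain ⟨h4, h5, h6⟩ := he f hf
      have h7 : (e f).2.Monic := h4.of_mul_monic_left (by rwa [h6])
      rw [← h6, h4.natDegree_mul h7] at h2
      have h8 : (e f).1.coeff 0 * (e f).2.coeff 0 = a := by rw [← mul_coeff_zero, h6, h3]
      rw [← h8] at ha
      exact mem_sigma.2 ⟨mem_filter.2 ⟨mem_monicsLT.2 ⟨h7, by dsimp only; omega,
        right_ne_zero_of_mul ha⟩, by dsimp only; omega⟩, mem_filter.2 ⟨mem_monicsLT.2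
        ⟨h4, by dsimp only; omega, left_ne_zero_of_mul ha⟩, h5, h8, by
          simpa only [h6] using hω f hf⟩⟩
    · intro f hf f' hf' h
      simp only [Sigma.mk.injEq, heq_eq_eq] at h
      rw [← (he f hf).2.2, ← (he f' hf').2.2, h.1, h.2]
  have hG : ∀ h ∈ H, (k : ℝ) * #(G h) ≤ 2 * (Fintype.card F : ℝ) ^ (k - 1) *
      ∑ g ∈ monicsLT F k with primeCount P (g * h) ≤ J,
        ((Fintype.card F : ℝ)⁻¹) ^ g.natDegree := by
    intro h hh
    obtain ⟨h1, -, h2⟩ := mem_monicsLT.1 (mem_filter.1 hh).1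
    refine mul_card_le_sum (a := a / h.coeff 0) (div_ne_zero ha h2) (fun g hg => ?_)
      fun g hg p i g' hp hmon hi hpg => ?_
    · obtain ⟨h3, h4, h5, -⟩ := mem_filter.1 hg
      exact ⟨(mem_monicsLT.1 h3).1, h4, eq_div_of_mul_eq h2 h5⟩
    · obtain ⟨h3, h4, -, h5⟩ := mem_filter.1 hg
      obtain ⟨h6, -, h7⟩ := mem_monicsLT.1 h3
      refine mem_filter.2 ⟨mem_monicsLT_of_pow_mul h6 h4 h7 hp hmon hi hpg,
        (primeCount_le_of_dvd P (mul_ne_zero h6.ne_zero h1.ne_zero) ?_).trans h5⟩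
      exact mul_dvd_mul_right ⟨p ^ i, by rw [← hpg, mul_comm]⟩ h
  have hH : ∀ g ∈ monicsLT F k, ((m + 1 : ℕ) : ℝ) * #{h ∈ H | primeCount P (g * h) ≤ J} ≤
      2 * (Fintype.card F : ℝ) ^ (m + 1) *
        ∑ h ∈ monicsLT F (m + 1) with primeCount P (g * h) ≤ J,
          ((Fintype.card F : ℝ)⁻¹) ^ h.natDegree := by
    intro g hg
    have h0 := (mem_monicsLT.1 hg).1.ne_zero
    have hc : ∀ c ∈ univ, ((m + 1 : ℕ) : ℝ) *
        #{h ∈ {h ∈ H | primeCount P (g * h) ≤ J} | h.coeff 0 = c} ≤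
          2 * (Fintype.card F : ℝ) ^ m *
            ∑ h ∈ monicsLT F (m + 1) with primeCount P (g * h) ≤ J,
              ((Fintype.card F : ℝ)⁻¹) ^ h.natDegree := by
      intro c _
      have hmem : ∀ h ∈ ({h ∈ {h ∈ H | primeCount P (g * h) ≤ J} | h.coeff 0 = c} :
          Finset F[X]), h.Monic ∧ h.natDegree = m + 1 ∧ h.coeff 0 = c ∧ c ≠ 0 ∧
            primeCount P (g * h) ≤ J := by
        intro h hh
        obtain ⟨h1, h2⟩ := mem_filter.1 hh
        obtain ⟨h3, h4⟩ := mem_filter.1 h1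
        obtain ⟨h5, h6⟩ := mem_filter.1 h3
        obtain ⟨h7, -, h8⟩ := mem_monicsLT.1 h5
        exact ⟨h7, h6, h2, h2 ▸ h8, h4⟩
      by_cases hc0 : c = 0
      · rw [card_eq_zero.2 (eq_empty_of_forall_notMem fun h hh => (hmem h hh).2.2.2.1 hc0)]
        have : 0 ≤ ∑ h ∈ monicsLT F (m + 1) with primeCount P (g * h) ≤ J,
          ((Fintype.card F : ℝ)⁻¹) ^ h.natDegree := sum_nonneg fun h _ => by positivity
        simp only [Nat.cast_zero, mul_zero]
        positivity
      · refine mul_card_le_sum hc0 (fun h hh => ?_) fun h hh p i h' hp hmon hi hph => ?_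
        · exact ⟨(hmem h hh).1, (hmem h hh).2.1, (hmem h hh).2.2.1⟩
        · obtain ⟨h1, h2, h3, -, h4⟩ := hmem h hh
          refine mem_filter.2 ⟨mem_monicsLT_of_pow_mul h1 h2 (h3 ▸ hc0) hp hmon hi hph,
            (primeCount_le_of_dvd P (mul_ne_zero h0 h1.ne_zero) ?_).trans h4⟩
          exact mul_dvd_mul_left g ⟨p ^ i, by rw [← hph, mul_comm]⟩
    rw [card_eq_sum_card_fiberwise (f := fun h : F[X] => h.coeff 0) (t := univ)
      fun _ _ => mem_coe.2 (mem_univ _), Nat.cast_sum, mul_sum]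
    refine (sum_le_sum hc).trans (le_of_eq ?_)
    rw [sum_const, nsmul_eq_mul, card_univ, pow_succ]
    ring
  have hT : ∑ g ∈ monicsLT F k, ((Fintype.card F : ℝ)⁻¹) ^ g.natDegree *
      ∑ h ∈ monicsLT F (m + 1) with primeCount P (g * h) ≤ J,
        ((Fintype.card F : ℝ)⁻¹) ^ h.natDegree ≤
      ∑ f ∈ monicsLT F (k + m + 1) with primeCount P f ≤ J,
        divisorCount k f * ((Fintype.card F : ℝ)⁻¹) ^ f.natDegree := by
    calc _ = ∑ z ∈ (monicsLT F k).sigma fun g =>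
            {h ∈ monicsLT F (m + 1) | primeCount P (g * h) ≤ J},
            ((Fintype.card F : ℝ)⁻¹) ^ z.1.natDegree *
              ((Fintype.card F : ℝ)⁻¹) ^ z.2.natDegree := by
          rw [sum_sigma]
          exact sum_congr rfl fun g _ => mul_sum _ _ _
      _ ≤ ∑ y ∈ ({f ∈ monicsLT F (k + m + 1) | primeCount P f ≤ J} : Finset F[X]).sigma
            fun f => {g ∈ monicsLT F k | g ∣ f}, ((Fintype.card F : ℝ)⁻¹) ^ y.1.natDegree := by
          refine sum_le_sum_of_injOn (fun z => ⟨z.1 * z.2, z.1⟩) ?_ ?_ ?_ fun y _ => by positivity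
          · rintro ⟨g, h⟩ hz
            obtain ⟨h1, h2⟩ := mem_sigma.1 hz
            obtain ⟨h3, h4⟩ := mem_filter.1 h2
            obtain ⟨h5, h6, h7⟩ := mem_monicsLT.1 h1
            obtain ⟨h8, h9, h10⟩ := mem_monicsLT.1 h3
            refine mem_sigma.2 ⟨mem_filter.2 ⟨mem_monicsLT.2 ⟨h5.mul h8, ?_, ?_⟩, h4⟩,
              mem_filter.2 ⟨h1, dvd_mul_right _ _⟩⟩
            · dsimp only at h5 h6 h8 h9 ⊢
              rw [h5.natDegree_mul h8]
              omega
            · rw [mul_coeff_zero]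
              exact mul_ne_zero h7 h10
          · rintro ⟨g, h⟩ hz ⟨g', h'⟩ _ heq
            simp only [Sigma.mk.injEq, heq_eq_eq] at heq
            obtain ⟨h1, rfl⟩ := heq
            have hg := (mem_monicsLT.1 (mem_sigma.1 (mem_coe.1 hz)).1).1.ne_zero
            rw [mul_left_cancel₀ hg h1]
          · rintro ⟨g, h⟩ hz
            obtain ⟨h1, h2⟩ := mem_sigma.1 hz
            rw [(mem_monicsLT.1 h1).1.natDegree_mul (mem_monicsLT.1 (mem_filter.1 h2).1).1,
              pow_add]
      _ = _ := by
          rw [sum_sigma]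
          refine sum_congr rfl fun f _ => ?_
          dsimp only
          rw [sum_const, nsmul_eq_mul, divisorCount]
  have hkA : (k : ℝ) * #A ≤ 2 * (Fintype.card F : ℝ) ^ (k - 1) *
      ∑ g ∈ monicsLT F k, ((Fintype.card F : ℝ)⁻¹) ^ g.natDegree *
        #{h ∈ H | primeCount P (g * h) ≤ J} := by
    calc (k : ℝ) * #A ≤ k * ∑ h ∈ H, (#(G h) : ℝ) := by
          gcongr
          exact_mod_cast hAG
      _ ≤ ∑ h ∈ H, 2 * (Fintype.card F : ℝ) ^ (k - 1) *
            ∑ g ∈ monicsLT F k with primeCount P (g * h) ≤ J,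
              ((Fintype.card F : ℝ)⁻¹) ^ g.natDegree := by
          rw [mul_sum]
          exact sum_le_sum hG
      _ = _ := by
          rw [← mul_sum]
          simp_rw [sum_filter]
          rw [sum_comm]
          congr 1
          refine sum_congr rfl fun g _ => ?_
          rw [← sum_filter, sum_const, nsmul_eq_mul, mul_comm]
  calc (k : ℝ) * (m + 1 : ℕ) * #A = (m + 1 : ℕ) * (k * #A) := by ring
    _ ≤ (m + 1 : ℕ) * (2 * (Fintype.card F : ℝ) ^ (k - 1) *
      ∑ g ∈ monicsLT F k, ((Fintype.card F : ℝ)⁻¹) ^ g.natDegree *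
        #{h ∈ H | primeCount P (g * h) ≤ J}) := by gcongr
    _ = 2 * (Fintype.card F : ℝ) ^ (k - 1) *
      ∑ g ∈ monicsLT F k, ((Fintype.card F : ℝ)⁻¹) ^ g.natDegree *
        ((m + 1 : ℕ) * #{h ∈ H | primeCount P (g * h) ≤ J}) := by
        rw [mul_left_comm, mul_sum]
        congr 1
        exact sum_congr rfl fun g _ => mul_left_comm _ _ _
    _ ≤ 2 * (Fintype.card F : ℝ) ^ (k - 1) *
      ∑ g ∈ monicsLT F k, ((Fintype.card F : ℝ)⁻¹) ^ g.natDegree *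
        (2 * (Fintype.card F : ℝ) ^ (m + 1) *
          ∑ h ∈ monicsLT F (m + 1) with primeCount P (g * h) ≤ J,
            ((Fintype.card F : ℝ)⁻¹) ^ h.natDegree) := by
        refine mul_le_mul_of_nonneg_left (sum_le_sum fun g hg => ?_) (by positivity)
        exact mul_le_mul_of_nonneg_left (hH g hg) (by positivity)
    _ = 4 * (Fintype.card F : ℝ) ^ (k + m) *
      ∑ g ∈ monicsLT F k, ((Fintype.card F : ℝ)⁻¹) ^ g.natDegree *
          ∑ h ∈ monicsLT F (m + 1) with primeCount P (g * h) ≤ J,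
            ((Fintype.card F : ℝ)⁻¹) ^ h.natDegree := by
        rw [show k + m = k - 1 + (m + 1) by omega, pow_add, mul_sum, mul_sum]
        exact sum_congr rfl fun g _ => by ring
    _ ≤ _ := mul_le_mul_of_nonneg_left hT (by positivity)

/-- Polynomials with few irreducible factors of degree at most `k` rarely have a divisor of
degree `k`. -/
theorem card_le_of_primeCount_le_ceil {A : Finset F[X]} {n k : ℕ} {a : F} (ha : a ≠ 0)
    (hk : 1 ≤ k) (hkn : 2 * k ≤ n) (hA : ∀ f ∈ A, f.Monic ∧ f.natDegree = n ∧ f.coeff 0 = a)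
    (hdvd : ∀ f ∈ A, ∃ g : F[X], g.Monic ∧ g.natDegree = k ∧ g ∣ f)
    (hω : ∀ f ∈ A, primeCount (· ≤ k) f ≤ ⌈(1 + Real.log k) / Real.log 2⌉₊) :
    (#A : ℝ) ≤ 64 * Real.exp 4 * Real.exp (1 - fordDelta) * ((Fintype.card F : ℝ) ^ (n - 1) *
      ((k : ℝ) ^ (-fordDelta) * (1 + Real.log k) ^ (-(1 / 2) : ℝ))) := by
  have hk1 : (1 : ℝ) ≤ k := by exact_mod_cast hk
  have hk0 : (0 : ℝ) < k := by linarith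
  have hn0 : (0 : ℝ) < n := by exact_mod_cast (by omega : 0 < n)
  have hq0 : (0 : ℝ) < Fintype.card F := zero_lt_one.trans (one_lt_card_cast F)
  have hm : (n : ℝ) / 2 ≤ (n - k : ℕ) := by
    rw [Nat.cast_sub (by omega)]
    have : (2 : ℝ) * k ≤ n := by exact_mod_cast hkn
    linarith
  have h1 := mul_mul_card_le_sum ha hk (by omega) hA hdvd hω
  have h2 := sum_range_ceil_le hk1
  generalize hJ : ⌈(1 + Real.log k) / Real.log 2⌉₊ = J at h1 h2
  have h3 : ∑ f ∈ monicsLT F n with primeCount (· ≤ k) f ≤ J,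
      divisorCount k f * ((Fintype.card F : ℝ)⁻¹) ^ f.natDegree ≤
        ∑ j ∈ range (J + 1), (2 * (1 + Real.log k) + 2) ^ j / j.factorial * (n / k) := by
    refine (sum_le_sum_primeCount_fiberwise (P := (· ≤ k)) (S := range (J + 1))
      (fun f => by positivity) fun f hf => ?_).trans
      (sum_le_sum fun j _ => sum_primeCount_eq_divisorCount_le hk (by omega) j)
    obtain ⟨h3, h4⟩ := mem_filter.1 hf
    exact ⟨h3, mem_range.2 (by omega)⟩
  rw [← sum_mul] at h3
  refine le_of_mul_le_mul_left ?_ (show 0 < (k : ℝ) * (n / 2) by positivity)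
  calc (k : ℝ) * (n / 2) * #A ≤ k * (n - k : ℕ) * #A := by gcongr
    _ ≤ _ := h1
    _ ≤ 4 * (Fintype.card F : ℝ) ^ (n - 1) * ((8 * Real.exp 4 * Real.exp (1 - fordDelta) * k *
          (k * (k : ℝ) ^ (-fordDelta) * (1 + Real.log k) ^ (-(1 / 2) : ℝ))) * (n / k)) := by
        refine mul_le_mul_of_nonneg_left (h3.trans ?_) (by positivity)
        exact mul_le_mul_of_nonneg_right h2 (by positivity)
    _ = _ := by
        field_simp
        ring

end MonicPolynomials

/-- **Multiplication table problem, unrestricted case.**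
The number of monic polynomials of degree `n` over a finite field with `q` elements, with
constant coefficient `a ≠ 0`, having a monic divisor of degree `k` (where `1 ≤ k ≤ n/2`), is
`≤ C qⁿ⁻¹ k^{-δ} (1 + log k)^{-1/2}`. -/
theorem stmt7 : ∃ C : ℝ, 0 < C ∧
    ∀ (F : Type) [Field F] [Fintype F], ∀ (q n k : ℕ) (a : F),
      Fintype.card F = q → 2 ≤ n → 1 ≤ k → 2 * k ≤ n → a ≠ 0 →
      ({f : F[X] | f.Monic ∧ f.natDegree = n ∧ f.coeff 0 = a ∧
          ∃ g : F[X], g.Monic ∧ g.natDegree = k ∧ g ∣ f}.ncard : ℝ) ≤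
        C * (q : ℝ) ^ (n - 1) * (k : ℝ) ^ (-fordDelta) *
          (1 + Real.log k) ^ (-(1 / 2) : ℝ) := by
  have he := Real.exp_pos (1 - fordDelta)
  refine ⟨8 * Real.exp (1 - fordDelta) + 64 * Real.exp 4 * Real.exp (1 - fordDelta),
    by positivity, ?_⟩
  rintro F _ _ q n k a rfl - hk hkn ha
  classical
  let A : Finset F[X] := {f ∈ monicsLT F (n + 1) | f.natDegree = n ∧ f.coeff 0 = a ∧
    ∃ g : F[X], g.Monic ∧ g.natDegree = k ∧ g ∣ f}
  have hA : ∀ f, f ∈ A ↔ f.Monic ∧ f.natDegree = n ∧ f.coeff 0 = a ∧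
      ∃ g : F[X], g.Monic ∧ g.natDegree = k ∧ g ∣ f := by
    intro f
    rw [Finset.mem_filter, mem_monicsLT]
    constructor
    · exact fun h => ⟨h.1.1, h.2⟩
    · rintro ⟨h1, h2, h3, h4⟩
      exact ⟨⟨h1, by omega, h3 ▸ ha⟩, h2, h3, h4⟩
  rw [show {f : F[X] | f.Monic ∧ f.natDegree = n ∧ f.coeff 0 = a ∧
      ∃ g : F[X], g.Monic ∧ g.natDegree = k ∧ g ∣ f} = (A : Set F[X]) by
    ext f
    exact (hA f).symm, Set.ncard_coe_finset]
  have h1 := card_le_of_ceil_lt_primeCount (n := n) (k := k)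
    (A := {f ∈ A | ⌈(1 + Real.log k) / Real.log 2⌉₊ < primeCount (· ≤ k) f}) ha hk (by omega)
    (fun f hf => by
      obtain ⟨h1, h2, h3, -⟩ := (hA f).1 (Finset.mem_filter.1 hf).1
      exact ⟨h1, h2, h3⟩) fun f hf => (Finset.mem_filter.1 hf).2
  have h2 := card_le_of_primeCount_le_ceil (n := n) (k := k)
    (A := {f ∈ A | ¬ ⌈(1 + Real.log k) / Real.log 2⌉₊ < primeCount (· ≤ k) f}) ha hk hkn
    (fun f hf => by
      obtain ⟨h1, h2, h3, -⟩ := (hA f).1 (Finset.mem_filter.1 hf).1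
      exact ⟨h1, h2, h3⟩)
    (fun f hf => ((hA f).1 (Finset.mem_filter.1 hf).1).2.2.2)
    fun f hf => not_lt.1 (Finset.mem_filter.1 hf).2
  rw [← Finset.card_filter_add_card_filter_not
    (fun f => ⌈(1 + Real.log k) / Real.log 2⌉₊ < primeCount (· ≤ k) f), Nat.cast_add]
  refine (add_le_add h1 h2).trans (le_of_eq ?_)
  ring
end
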